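/- arXiv:1908.04033 — 2 statements merged into one kernel-verified Lean document; each statement's English description precedes it below -/
import Mathlib

section
/- Assume (ln n)/d → ∞ (this includes the case of fixed d ≥ 2). Define K_d = (2^d π^{d/2−1}/(d(d−1)²))·(Γ((d²−2d+2)/2)/Γ((d²−2d+1)/2))·(Γ((d+1)/2)/Γ(d/2))^{d−1} and h_* = √(1 − d^{3/(d−1)} n^{−2/(d−1)}). Then F(n,d,−1,1)/(n·K_d·h_*^{d−1}) → 1 as n → ∞. If moreover (ln n)/(d·ln d) → ∞ (equivalently n^{1/d}/d → ∞, which includes fixed d), then F(n,d,−1,1)/(n·K_d) → 1. -/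
open Filter

noncomputable def c1 (d : ℕ) : ℝ :=
  Real.Gamma ((d : ℝ) / 2) / (Real.sqrt Real.pi * Real.Gamma (((d : ℝ) - 1) / 2))

noncomputable def c2 (d : ℕ) : ℝ :=
  Real.Gamma (((d : ℝ) ^ 2 - 2 * (d : ℝ) + 2) / 2) /
    (Real.sqrt Real.pi * Real.Gamma (((d : ℝ) ^ 2 - 2 * (d : ℝ) + 1) / 2))

/-- `II n d a b` is the integral `I(n,d,a,b)` from the paper. -/
noncomputable def II (n d : ℕ) (a b : ℝ) : ℝ :=
  ∫ h in a..b, (1 - h ^ 2) ^ (((d : ℝ) ^ 2 - 2 * (d : ℝ) - 1) / 2) *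
    (c1 d * ∫ s in (-1 : ℝ)..h, (1 - s ^ 2) ^ (((d : ℝ) - 3) / 2)) ^ (n - d)

/-- `FF n d a b` is the expected number of facets with height in `[a,b]`. -/
noncomputable def FF (n d : ℕ) (a b : ℝ) : ℝ :=
  (n.choose d : ℝ) * 2 * c2 d * II n d a b

/-- The standard normal CDF. -/
noncomputable def stdPhi (r : ℝ) : ℝ :=
  (Real.sqrt (2 * Real.pi))⁻¹ * ∫ s in Set.Iic r, Real.exp (-s ^ 2 / 2)

/-- The constant `K_d` of Kabluchko–Thäle–Zaporozhets. -/
noncomputable def Kd (d : ℕ) : ℝ :=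
  (2 : ℝ) ^ d * Real.pi ^ ((d : ℝ) / 2 - 1) / ((d : ℝ) * ((d : ℝ) - 1) ^ 2) *
    (Real.Gamma (((d : ℝ) ^ 2 - 2 * (d : ℝ) + 2) / 2) /
      Real.Gamma (((d : ℝ) ^ 2 - 2 * (d : ℝ) + 1) / 2)) *
    (Real.Gamma (((d : ℝ) + 1) / 2) / Real.Gamma ((d : ℝ) / 2)) ^ (d - 1)

/-- `h_* = √(1 - d^{3/(d-1)} n^{-2/(d-1)})`. -/
noncomputable def hstar (n d : ℕ) : ℝ :=
  Real.sqrt (1 - (d : ℝ) ^ (3 / ((d : ℝ) - 1)) * (n : ℝ) ^ (-2 / ((d : ℝ) - 1)))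

/-- The real Beta integral. -/
lemma integral_rpow_mul_one_sub_rpow {a b : ℝ} (ha : 0 < a) (hb : 0 < b) :
    ∫ x in (0 : ℝ)..1, x ^ (a - 1) * (1 - x) ^ (b - 1) =
      Real.Gamma a * Real.Gamma b / Real.Gamma (a + b) := by
  have h := ProbabilityTheory.beta_eq_betaIntegralReal a b ha hb
  rw [ProbabilityTheory.beta, Complex.betaIntegral] at h
  rw [h]
  have h2 : ∫ x in (0 : ℝ)..1, (x : ℂ) ^ ((a : ℂ) - 1) * (1 - (x : ℂ)) ^ ((b : ℂ) - 1) =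
      ((∫ x in (0 : ℝ)..1, x ^ (a - 1) * (1 - x) ^ (b - 1) : ℝ) : ℂ) := by
    rw [← intervalIntegral.integral_ofReal]
    refine intervalIntegral.integral_congr fun x hx => ?_
    rw [Set.uIcc_of_le zero_le_one] at hx
    have h0 : 0 ≤ 1 - x := by linarith [hx.2]
    simp only [Complex.ofReal_mul]
    rw [Complex.ofReal_cpow hx.1, Complex.ofReal_cpow h0]
    push_cast
    ring
  rw [h2, Complex.ofReal_re]

lemma integral_pow_mul_one_sub_pow (j k : ℕ) :
    ∫ x in (0 : ℝ)..1, (1 - x) ^ j * x ^ k =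
      (j.factorial : ℝ) * k.factorial / (j + k + 1).factorial := by
  have h := integral_rpow_mul_one_sub_rpow (a := k + 1) (b := j + 1) (by positivity) (by positivity)
  rw [Real.Gamma_nat_eq_factorial, Real.Gamma_nat_eq_factorial,
    show (k : ℝ) + 1 + (j + 1) = ((j + k + 1 : ℕ) : ℝ) + 1 by push_cast; ring,
    Real.Gamma_nat_eq_factorial] at h
  simp only [add_sub_cancel_right, Real.rpow_natCast] at h
  rw [mul_comm (j.factorial : ℝ), ← h]
  simp only [mul_comm]

lemma integral_one_sub_sq_rpow {m : ℝ} (hm : 0 < m) :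
    ∫ s in (-1 : ℝ)..1, (1 - s ^ 2) ^ (m - 1) =
      Real.sqrt Real.pi * Real.Gamma m / Real.Gamma (m + 1 / 2) := by
  have h1 := intervalIntegral.integral_comp_mul_sub (a := 0) (b := 1)
    (fun s : ℝ => (1 - s ^ 2) ^ (m - 1)) (two_ne_zero) 1
  norm_num at h1
  have h2 : ∫ x in (0 : ℝ)..1, (1 - (2 * x - 1) ^ 2) ^ (m - 1) =
      4 ^ (m - 1) * ∫ x in (0 : ℝ)..1, x ^ (m - 1) * (1 - x) ^ (m - 1) := by
    rw [← intervalIntegral.integral_const_mul]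
    refine intervalIntegral.integral_congr fun x hx => ?_
    rw [Set.uIcc_of_le zero_le_one] at hx
    have h0 : 0 ≤ 1 - x := by linarith [hx.2]
    have h3 : (1 - (2 * x - 1) ^ 2) = 4 * (x * (1 - x)) := by ring
    simp only [h3]
    rw [Real.mul_rpow (by norm_num) (mul_nonneg hx.1 h0), Real.mul_rpow hx.1 h0]
  rw [h2, integral_rpow_mul_one_sub_rpow hm hm] at h1
  have h4 := Real.Gamma_mul_Gamma_add_half m
  have h5 : (4 : ℝ) ^ (m - 1) = 2 ^ (2 * m) / 4 := by
    rw [Real.rpow_sub (by norm_num), Real.rpow_mul (by norm_num)]; norm_num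
  have h6 : (2 : ℝ) ^ (1 - 2 * m) = 2 / 2 ^ (2 * m) := by
    rw [Real.rpow_sub (by norm_num)]; norm_num
  rw [h6] at h4
  rw [h5, ← two_mul] at h1
  have g1 := Real.Gamma_pos_of_pos hm
  have g2 := Real.Gamma_pos_of_pos (show 0 < m + 1 / 2 by linarith)
  have g3 := Real.Gamma_pos_of_pos (show 0 < 2 * m by linarith)
  have g4 : (0 : ℝ) < 2 ^ (2 * m) := by positivity
  generalize Real.Gamma (m + 1 / 2) = X at *
  generalize Real.Gamma (2 * m) = Y at *
  generalize Real.Gamma m = Z at *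
  generalize (2 : ℝ) ^ (2 * m) = T at *
  generalize (∫ s in (-1 : ℝ)..1, (1 - s ^ 2) ^ (m - 1)) = J at *
  field_simp at h4 h1 ⊢
  have h7 : Y * (J * X) = Y * (√Real.pi * Z) := by
    linear_combination (-1 / 4 : ℝ) * X * h1 + (1 / 2 : ℝ) * Z * h4
  linear_combination mul_left_cancel₀ g3.ne' h7

lemma c1_pos {d : ℕ} (hd : 2 ≤ d) : 0 < c1 d := by
  have h : (2 : ℝ) ≤ d := by exact_mod_cast hd
  have g1 := Real.Gamma_pos_of_pos (show 0 < (d : ℝ) / 2 by linarith)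
  have g2 := Real.Gamma_pos_of_pos (show 0 < ((d : ℝ) - 1) / 2 by linarith)
  have := Real.pi_pos
  unfold c1
  positivity

lemma c1_mul_integral {d : ℕ} (hd : 2 ≤ d) :
    c1 d * ∫ s in (-1 : ℝ)..1, (1 - s ^ 2) ^ (((d : ℝ) - 3) / 2) = 1 := by
  have h : (2 : ℝ) ≤ d := by exact_mod_cast hd
  have h1 := integral_one_sub_sq_rpow (m := ((d : ℝ) - 1) / 2) (by linarith)
  rw [show ((d : ℝ) - 1) / 2 - 1 = ((d : ℝ) - 3) / 2 by ring,
    show ((d : ℝ) - 1) / 2 + 1 / 2 = (d : ℝ) / 2 by ring] at h1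
  rw [h1, c1]
  have g1 := Real.Gamma_pos_of_pos (show 0 < (d : ℝ) / 2 by linarith)
  have g2 := Real.Gamma_pos_of_pos (show 0 < ((d : ℝ) - 1) / 2 by linarith)
  have := Real.sqrt_pos.2 Real.pi_pos
  field_simp

lemma Gamma_midpoint_sq_le {a b : ℝ} (ha : 0 < a) (hb : 0 < b) :
    Real.Gamma ((a + b) / 2) ^ 2 ≤ Real.Gamma a * Real.Gamma b := by
  have h := Real.Gamma_mul_add_mul_le_rpow_Gamma_mul_rpow_Gamma ha hb
    (a := 1 / 2) (b := 1 / 2) (by norm_num) (by norm_num) (by norm_num)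
  have g1 := Real.Gamma_pos_of_pos ha
  have g2 := Real.Gamma_pos_of_pos hb
  rw [← Real.sqrt_eq_rpow, ← Real.sqrt_eq_rpow, ← Real.sqrt_mul g1.le,
    show 1 / 2 * a + 1 / 2 * b = (a + b) / 2 by ring] at h
  have g3 := Real.Gamma_pos_of_pos (show 0 < (a + b) / 2 by linarith)
  exact (Real.le_sqrt g3.le (by positivity)).1 h

lemma c1_sq_le {d : ℕ} (hd : 2 ≤ d) : c1 d ^ 2 * Real.pi ≤ ((d : ℝ) - 1) / 2 := by
  have h : (2 : ℝ) ≤ d := by exact_mod_cast hd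
  have g2 := Real.Gamma_pos_of_pos (show 0 < ((d : ℝ) - 1) / 2 by linarith)
  have h1 := Gamma_midpoint_sq_le (a := ((d : ℝ) - 1) / 2) (b := ((d : ℝ) - 1) / 2 + 1)
    (by linarith) (by linarith)
  rw [Real.Gamma_add_one (by linarith),
    show (((d : ℝ) - 1) / 2 + (((d : ℝ) - 1) / 2 + 1)) / 2 = (d : ℝ) / 2 by ring] at h1
  have h2 : c1 d ^ 2 * Real.pi = Real.Gamma ((d : ℝ) / 2) ^ 2 /
      Real.Gamma (((d : ℝ) - 1) / 2) ^ 2 := by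
    rw [c1, div_pow, mul_pow, Real.sq_sqrt Real.pi_pos.le]
    have := Real.pi_pos
    field_simp
  rw [h2, div_le_iff₀ (by positivity)]
  linarith

lemma le_c1_sq {d : ℕ} (hd : 3 ≤ d) : ((d : ℝ) - 2) / 2 ≤ c1 d ^ 2 * Real.pi := by
  have h : (3 : ℝ) ≤ d := by exact_mod_cast hd
  have g1 := Real.Gamma_pos_of_pos (show 0 < ((d : ℝ) - 2) / 2 by linarith)
  have g2 := Real.Gamma_pos_of_pos (show 0 < ((d : ℝ) - 1) / 2 by linarith)
  have h1 := Gamma_midpoint_sq_le (a := ((d : ℝ) - 2) / 2) (b := ((d : ℝ) - 2) / 2 + 1)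
    (by linarith) (by linarith)
  rw [show (((d : ℝ) - 2) / 2 + (((d : ℝ) - 2) / 2 + 1)) / 2 = ((d : ℝ) - 1) / 2 by ring] at h1
  have h2 : c1 d ^ 2 * Real.pi = Real.Gamma ((d : ℝ) / 2) ^ 2 /
      Real.Gamma (((d : ℝ) - 1) / 2) ^ 2 := by
    rw [c1, div_pow, mul_pow, Real.sq_sqrt Real.pi_pos.le]
    have := Real.pi_pos
    field_simp
  rw [h2, le_div_iff₀ (by positivity)]
  have h3 := Real.Gamma_add_one (s := ((d : ℝ) - 2) / 2) (by linarith)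
  rw [show ((d : ℝ) - 2) / 2 + 1 = (d : ℝ) / 2 by ring] at h3 h1
  calc _ ≤ ((d : ℝ) - 2) / 2 * (Real.Gamma (((d : ℝ) - 2) / 2) * Real.Gamma ((d : ℝ) / 2)) :=
        mul_le_mul_of_nonneg_left h1 (by linarith)
    _ = _ := by rw [← mul_assoc, ← h3]; ring

lemma continuous_one_sub_sq_rpow {r : ℝ} (hr : 0 ≤ r) :
    Continuous fun s : ℝ => (1 - s ^ 2) ^ r :=
  (continuous_const.sub (continuous_pow 2)).rpow_const fun _ => Or.inr hr

lemma hasDerivAt_one_sub_sq_rpow {m : ℝ} (hm : 1 ≤ m) (h : ℝ) :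
    HasDerivAt (fun s : ℝ => (1 - s ^ 2) ^ m) (-(2 * m) * h * (1 - h ^ 2) ^ (m - 1)) h := by
  have h1 : HasDerivAt (fun s : ℝ => 1 - s ^ 2) (-(2 * h)) h := by
    simpa using (hasDerivAt_pow 2 h).const_sub 1
  refine (h1.rpow_const (Or.inr hm)).congr_deriv ?_
  ring

/-- The tail integral of the density `(1 - s ^ 2) ^ (m - 1)`, scaled by `2 * m`. -/
noncomputable def capTail (m h : ℝ) : ℝ := 2 * m * ∫ s in h..1, (1 - s ^ 2) ^ (m - 1)

lemma capTail_one (m : ℝ) : capTail m 1 = 0 := by simp [capTail]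

lemma hasDerivAt_capTail {m : ℝ} (hm : 1 ≤ m) (h : ℝ) :
    HasDerivAt (capTail m) (-(2 * m) * (1 - h ^ 2) ^ (m - 1)) h := by
  have hc := continuous_one_sub_sq_rpow (r := m - 1) (by linarith)
  have h1 := (intervalIntegral.integral_hasDerivAt_left (hc.intervalIntegrable h 1)
    hc.stronglyMeasurable.stronglyMeasurableAtFilter hc.continuousAt).const_mul (2 * m)
  refine HasDerivAt.congr_deriv h1 ?_
  ring

lemma one_sub_sq_nonneg {h : ℝ} (h0 : -1 ≤ h) (h1 : h ≤ 1) : 0 ≤ 1 - h ^ 2 := by nlinarith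

lemma capTail_antitoneOn {m : ℝ} (hm : 1 ≤ m) : AntitoneOn (capTail m) (Set.Icc (-1) 1) := by
  refine antitoneOn_of_deriv_nonpos (convex_Icc _ _)
    (fun h _ => (hasDerivAt_capTail hm h).continuousAt.continuousWithinAt)
    (fun h _ => (hasDerivAt_capTail hm h).differentiableAt.differentiableWithinAt) fun h hh => ?_
  rw [interior_Icc] at hh
  rw [(hasDerivAt_capTail hm h).deriv]
  have := Real.rpow_nonneg (one_sub_sq_nonneg hh.1.le hh.2.le) (m - 1)
  nlinarith

lemma capTail_nonneg {m h : ℝ} (hm : 1 ≤ m) (h0 : -1 ≤ h) (h1 : h ≤ 1) : 0 ≤ capTail m h := by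
  rw [← capTail_one m]
  exact capTail_antitoneOn hm ⟨h0, h1⟩ ⟨by norm_num, le_rfl⟩ h1

lemma mul_capTail_le {m h : ℝ} (hm : 1 ≤ m) (h0 : 0 ≤ h) (h1 : h ≤ 1) :
    h * capTail m h ≤ (1 - h ^ 2) ^ m := by
  have hd : ∀ x, HasDerivAt (fun x => (1 - x ^ 2) ^ m - x * capTail m x) (-capTail m x) x := by
    intro x
    refine HasDerivAt.congr_deriv
      ((hasDerivAt_one_sub_sq_rpow hm x).sub ((hasDerivAt_id x).mul (hasDerivAt_capTail hm x))) ?_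
    simp only [id]
    ring
  have ha : AntitoneOn (fun x => (1 - x ^ 2) ^ m - x * capTail m x) (Set.Icc 0 1) := by
    refine antitoneOn_of_deriv_nonpos (convex_Icc _ _)
      (fun h _ => (hd h).continuousAt.continuousWithinAt)
      (fun h _ => (hd h).differentiableAt.differentiableWithinAt) fun h hh => ?_
    rw [interior_Icc] at hh
    rw [(hd h).deriv]
    linarith [capTail_nonneg hm (by linarith [hh.1]) hh.2.le]
  have := ha ⟨h0, h1⟩ ⟨zero_le_one, le_rfl⟩ h1
  simp only [capTail_one] at this
  have h2 : (0 : ℝ) ≤ (1 - 1 ^ 2) ^ m := by norm_num; exact Real.rpow_nonneg le_rfl _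
  linarith

lemma cubic_ineq {m u : ℝ} (hm : 1 ≤ m) (hu1 : u ≤ 1) :
    (1 - u) * (2 * m * (1 - m / (m + 1) * u) + m / (m + 1) * u) ^ 2 ≤
      (2 * m) ^ 2 * (1 - m / (m + 1) * u) ^ 3 := by
  have hm1 : 0 < m + 1 := by linarith
  have key : (2 * m) ^ 2 * (1 - m / (m + 1) * u) ^ 3 -
      (1 - u) * (2 * m * (1 - m / (m + 1) * u) + m / (m + 1) * u) ^ 2 =
      m ^ 2 * u ^ 2 * (3 * (m + 1) + u * (1 - 3 * m)) / (m + 1) ^ 3 := by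
    field_simp
    ring
  have h2 : 0 ≤ 3 * (m + 1) + u * (1 - 3 * m) := by nlinarith
  have : 0 ≤ m ^ 2 * u ^ 2 * (3 * (m + 1) + u * (1 - 3 * m)) / (m + 1) ^ 3 := by positivity
  linarith

lemma one_sub_sq_rpow_le_sqrt_mul_capTail_of_nonneg {m h : ℝ}
    (hm : 1 ≤ m) (h0 : 0 ≤ h) (h1 : h ≤ 1) :
    (1 - h ^ 2) ^ m ≤ Real.sqrt (1 - m / (m + 1) * (1 - h ^ 2)) * capTail m h := by
  have hm1 : 0 < m + 1 := by linarith
  set ρ := m / (m + 1) with hρ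
  have hρ1 : ρ < 1 := by rw [hρ, div_lt_one hm1]; linarith
  have hρ0 : 0 ≤ ρ := by positivity
  have hD : ∀ x : ℝ, 0 < 1 - ρ * (1 - x ^ 2) := fun x => by nlinarith [mul_nonneg hρ0 (sq_nonneg x)]
  have hdD : ∀ x : ℝ, HasDerivAt (fun x : ℝ => Real.sqrt (1 - ρ * (1 - x ^ 2)))
      (ρ * x / Real.sqrt (1 - ρ * (1 - x ^ 2))) x := by
    intro x
    have e1 : HasDerivAt (fun x : ℝ => 1 - ρ * (1 - x ^ 2)) (2 * ρ * x) x := by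
      have := (((hasDerivAt_pow 2 x).const_sub 1).const_mul ρ).const_sub 1
      refine this.congr_deriv ?_
      norm_num
      ring
    refine (e1.sqrt (hD x).ne').congr_deriv ?_
    have := Real.sqrt_pos.2 (hD x)
    field_simp
  have hd : ∀ x, HasDerivAt
      (fun x => capTail m x - (1 - x ^ 2) ^ m / Real.sqrt (1 - ρ * (1 - x ^ 2)))
      (-(2 * m) * (1 - x ^ 2) ^ (m - 1) -
        ((-(2 * m) * x * (1 - x ^ 2) ^ (m - 1)) * Real.sqrt (1 - ρ * (1 - x ^ 2)) -
          (1 - x ^ 2) ^ m * (ρ * x / Real.sqrt (1 - ρ * (1 - x ^ 2)))) /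
          Real.sqrt (1 - ρ * (1 - x ^ 2)) ^ 2) x := fun x =>
    (hasDerivAt_capTail hm x).sub ((hasDerivAt_one_sub_sq_rpow hm x).div (hdD x)
      (Real.sqrt_pos.2 (hD x)).ne')
  have ha : AntitoneOn (fun x => capTail m x - (1 - x ^ 2) ^ m / Real.sqrt (1 - ρ * (1 - x ^ 2)))
      (Set.Icc 0 1) := by
    refine antitoneOn_of_deriv_nonpos (convex_Icc _ _)
      (fun h _ => (hd h).continuousAt.continuousWithinAt)
      (fun h _ => (hd h).differentiableAt.differentiableWithinAt) fun x hx => ?_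
    rw [interior_Icc] at hx
    rw [(hd x).deriv]
    have hu : 0 < 1 - x ^ 2 := by nlinarith [hx.1, hx.2]
    have hs := Real.sqrt_pos.2 (hD x)
    have hss := Real.sq_sqrt (hD x).le
    have hW : (1 - x ^ 2) ^ m = (1 - x ^ 2) ^ (m - 1) * (1 - x ^ 2) := by
      rw [← Real.rpow_add_one hu.ne']; ring_nf
    have hU := Real.rpow_pos_of_pos hu (m - 1)
    have hc := cubic_ineq hm (u := 1 - x ^ 2) (by nlinarith)
    rw [hW]
    rw [← hρ] at hc
    set S := Real.sqrt (1 - ρ * (1 - x ^ 2)) with hS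
    have hx2 : x * (2 * m * S ^ 2 + ρ * (1 - x ^ 2)) ≤ 2 * m * S ^ 3 := by
      refine abs_le_of_sq_le_sq' ?_ (by positivity) |>.2
      rw [← hss] at hc
      calc _ = (1 - (1 - x ^ 2)) * (2 * m * S ^ 2 + ρ * (1 - x ^ 2)) ^ 2 := by ring
        _ ≤ _ := hc
        _ = _ := by ring
    have : -(2 * m) * (1 - x ^ 2) ^ (m - 1) -
        ((-(2 * m) * x * (1 - x ^ 2) ^ (m - 1)) * S -
          (1 - x ^ 2) ^ (m - 1) * (1 - x ^ 2) * (ρ * x / S)) / S ^ 2 =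
        (1 - x ^ 2) ^ (m - 1) / S ^ 3 *
          (x * (2 * m * S ^ 2 + ρ * (1 - x ^ 2)) - 2 * m * S ^ 3) := by
      field_simp
      ring
    rw [this]
    exact mul_nonpos_of_nonneg_of_nonpos (by positivity) (by linarith)
  have h2 := ha ⟨h0, h1⟩ ⟨zero_le_one, le_rfl⟩ h1
  have h3 : ((1 : ℝ) - 1 ^ 2) ^ m = 0 := by
    norm_num
    exact Real.zero_rpow (by linarith)
  simp only [capTail_one, h3, zero_div, sub_zero] at h2
  rw [mul_comm, ← div_le_iff₀ (Real.sqrt_pos.2 (hD h))]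
  linarith

lemma one_sub_sq_rpow_le_sqrt_mul_capTail {m h : ℝ} (hm : 1 ≤ m) (h0 : -1 ≤ h) (h1 : h ≤ 1) :
    (1 - h ^ 2) ^ m ≤ Real.sqrt (1 - m / (m + 1) * (1 - h ^ 2)) * capTail m h := by
  rcases le_total 0 h with hp | hn
  · exact one_sub_sq_rpow_le_sqrt_mul_capTail_of_nonneg hm hp h1
  · have h2 := one_sub_sq_rpow_le_sqrt_mul_capTail_of_nonneg hm (h := -h) (by linarith) (by linarith)
    rw [neg_sq] at h2
    refine h2.trans (mul_le_mul_of_nonneg_left ?_ (Real.sqrt_nonneg _))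
    exact capTail_antitoneOn hm ⟨h0, h1⟩ ⟨by linarith, by linarith⟩ (by linarith)

lemma one_sub_sq_rpow_le_capTail {m h : ℝ} (hm : 1 ≤ m) (h0 : -1 ≤ h) (h1 : h ≤ 1) :
    (1 - h ^ 2) ^ m ≤ capTail m h := by
  refine (one_sub_sq_rpow_le_sqrt_mul_capTail hm h0 h1).trans ?_
  refine mul_le_of_le_one_left (capTail_nonneg hm h0 h1) ?_
  rw [Real.sqrt_le_one]
  have : 0 ≤ m / (m + 1) * (1 - h ^ 2) :=
    mul_nonneg (div_nonneg (by linarith) (by linarith)) (one_sub_sq_nonneg h0 h1)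
  linarith

lemma tangent_le_one_sub_rpow {m ε t Q : ℝ} (hm : 1 ≤ m) (hε0 : 0 < ε) (hε1 : ε < 1)
    (ht0 : 0 ≤ t) (ht1 : t ≤ 1) (htQ : t ^ m ≤ Q) :
    (1 - ε) ^ m * (1 - ε / (1 - ε) * (Q / ε ^ m - 1)) ≤ (1 - t) ^ m := by
  have hm0 : 0 < m := by linarith
  have h1ε : 0 < 1 - ε := by linarith
  have hεm : 0 < ε ^ m := Real.rpow_pos_of_pos hε0 m
  have hQ : 0 ≤ Q := (Real.rpow_nonneg ht0 m).trans htQ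
  have hB := one_add_mul_self_le_rpow_one_add (s := (1 - t) / (1 - ε) - 1)
    (by linarith [div_nonneg (sub_nonneg.2 ht1) h1ε.le]) hm
  rw [add_sub_cancel, Real.div_rpow (by linarith) h1ε.le,
    le_div_iff₀ (Real.rpow_pos_of_pos h1ε m)] at hB
  have hC := rpow_one_add_le_one_add_mul_self (s := Q / ε ^ m - 1) (p := 1 / m)
    (by linarith [div_nonneg hQ hεm.le]) (by positivity) (by rw [div_le_one hm0]; exact hm)
  rw [add_sub_cancel] at hC
  have hD : t / ε ≤ (Q / ε ^ m) ^ (1 / m) := by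
    have : t / ε = ((t / ε) ^ m) ^ (1 / m) := by
      rw [← Real.rpow_mul (by positivity), mul_one_div_cancel hm0.ne', Real.rpow_one]
    rw [this, Real.div_rpow ht0 hε0.le]
    gcongr
  refine le_trans ?_ hB
  rw [mul_comm]
  refine mul_le_mul_of_nonneg_right ?_ (Real.rpow_nonneg h1ε.le m)
  have e1 : m * ((1 - t) / (1 - ε) - 1) = -(ε / (1 - ε)) * (m * (t / ε - 1)) := by
    field_simp
    ring
  rw [e1]
  have e2 : m * (t / ε - 1) ≤ Q / ε ^ m - 1 := by
    have : t / ε - 1 ≤ 1 / m * (Q / ε ^ m - 1) := by linarith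
    calc _ ≤ m * (1 / m * (Q / ε ^ m - 1)) := by gcongr
      _ = _ := by field_simp
  have := mul_le_mul_of_nonneg_left e2 (div_pos hε0 h1ε).le
  linarith

lemma rpow_le_of_le_sqrt {m ε u g Q : ℝ} (hm : 1 ≤ m) (hε0 : 0 < ε) (hε1 : ε ≤ 1 / 2)
    (hu0 : 0 < u) (hu1 : u ≤ 1) (hg0 : 0 < g) (hQ : 0 < Q) (huQ : u ^ m = Q * g)
    (hg : g ≤ Real.sqrt (1 - m / (m + 1) * u)) :
    g ^ (2 * m - 1) ≤ (1 - ε) ^ (m - 1) * (1 + ε / (1 - ε) * (3 * ε ^ m / Q)) := by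
  have hm0 : 0 < m := by linarith
  have h1ε : 0 < 1 - ε := by linarith
  have hεm : 0 < ε ^ m := Real.rpow_pos_of_pos hε0 m
  set κ := ε / (1 - ε) with hκ
  have hκ0 : 0 < κ := by positivity
  have hκ1 : κ ≤ 1 := by rw [hκ, div_le_one h1ε]; linarith
  set ρ := m / (m + 1) with hρ
  have hρ0 : 0 < ρ := by positivity
  have hρ1 : ρ < 1 := by rw [hρ, div_lt_one (by linarith)]; linarith
  have hv0 : 0 < ρ * u := by positivity
  have hv1 : ρ * u < 1 := by nlinarith
  have hlogρ : -1 ≤ m * Real.log ρ := by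
    have h1 := Real.log_le_sub_one_of_pos (inv_pos.2 hρ0)
    rw [Real.log_inv] at h1
    have h2 : ρ⁻¹ - 1 = 1 / m := by rw [hρ]; field_simp; ring
    rw [h2] at h1
    have := mul_le_mul_of_nonneg_left h1 hm0.le
    rw [mul_one_div_cancel hm0.ne'] at this
    linarith
  have hlogu : m * Real.log u = Real.log Q + Real.log g := by
    rw [← Real.log_rpow hu0, huQ, Real.log_mul hQ.ne' hg0.ne']
  have hlogg : 2 * Real.log g ≤ Real.log (1 - ρ * u) := by
    have h1 := Real.log_le_log hg0 hg
    rw [Real.log_sqrt (by linarith)] at h1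
    linarith
  have hlogv : Real.log (1 - ρ * u) ≤
      Real.log (1 - ε) - κ * (Real.log ρ + Real.log u - Real.log ε) := by
    have h1 := Real.log_le_sub_one_of_pos (div_pos (sub_pos.2 hv1) h1ε)
    rw [Real.log_div (by linarith) h1ε.ne'] at h1
    have h2 := Real.log_le_sub_one_of_pos (div_pos hv0 hε0)
    rw [Real.log_div hv0.ne' hε0.ne', Real.log_mul hρ0.ne' hu0.ne'] at h2
    have h3 : (1 - ρ * u) / (1 - ε) - 1 = -κ * (ρ * u / ε - 1) := by
      rw [hκ]; field_simp; ring
    have h4 := mul_le_mul_of_nonneg_left h2 hκ0.le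
    linarith
  set L := Real.log g with hL
  set l := Real.log (1 - ε) with hl
  have hl0 : l ≤ 0 := Real.log_nonpos h1ε.le (by linarith)
  set Y := 1 + m * Real.log ε - Real.log Q with hY
  have hmain : (2 * m + κ) * L ≤ m * l + κ * Y := by
    have h1 := mul_le_mul_of_nonneg_left (hlogg.trans hlogv) hm0.le
    have h2 := mul_le_mul_of_nonneg_left hlogρ hκ0.le
    have h3 : m * (l - κ * (Real.log ρ + Real.log u - Real.log ε)) =
      m * l - κ * (m * Real.log ρ) - κ * (Real.log Q + L) + κ * (m * Real.log ε) := by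
      rw [← hlogu]; ring
    rw [h3] at h1
    rw [hY]
    nlinarith
  set θ := (2 * m - 1) / (2 * m + κ) with hθ
  have hmκ : 0 < 2 * m + κ := by linarith
  have hθ0 : 0 ≤ θ := div_nonneg (by linarith) hmκ.le
  have hθ1 : θ ≤ 1 := by rw [hθ, div_le_one hmκ]; linarith
  have hθm : m - 1 ≤ θ * m := by
    rw [hθ, div_mul_eq_mul_div, le_div_iff₀ hmκ]
    nlinarith
  have hmain2 : L * (2 * m - 1) ≤ (m - 1) * l + θ * κ * Y := by
    have h1 := mul_le_mul_of_nonneg_left hmain hθ0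
    have h2 : θ * ((2 * m + κ) * L) = L * (2 * m - 1) := by rw [hθ]; field_simp
    have h3 := mul_le_mul_of_nonpos_right hθm hl0
    rw [h2] at h1
    linarith
  have hexpY : Real.exp Y = Real.exp 1 * ε ^ m / Q := by
    rw [hY, Real.exp_sub, Real.exp_add, Real.exp_log hQ, mul_comm m, ← Real.rpow_def_of_pos hε0]
  have hB := rpow_one_add_le_one_add_mul_self (s := Real.exp Y - 1) (p := θ * κ)
    (by linarith [Real.exp_pos Y]) (by positivity) (mul_le_one₀ hθ1 hκ0.le hκ1)
  rw [add_sub_cancel, ← Real.exp_mul] at hB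
  have he3 : Real.exp Y ≤ 3 * ε ^ m / Q := by
    rw [hexpY]
    have := Real.exp_one_lt_d9
    gcongr
    linarith
  have hB2 : 1 + θ * κ * (Real.exp Y - 1) ≤ 1 + κ * (3 * ε ^ m / Q) := by
    have h1 : θ * κ ≤ κ := by nlinarith
    have h2 : θ * κ * Real.exp Y ≤ κ * (3 * ε ^ m / Q) := by gcongr
    have h3 : 0 ≤ θ * κ := by positivity
    linarith
  calc g ^ (2 * m - 1) = Real.exp (L * (2 * m - 1)) := Real.rpow_def_of_pos hg0 _
    _ ≤ Real.exp ((m - 1) * l + θ * κ * Y) := Real.exp_le_exp.2 hmain2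
    _ = (1 - ε) ^ (m - 1) * Real.exp (Y * (θ * κ)) := by
        rw [Real.exp_add, Real.rpow_def_of_pos h1ε, ← hl]
        ring_nf
    _ ≤ _ := mul_le_mul_of_nonneg_left (hB.trans hB2) (Real.rpow_nonneg h1ε.le _)

lemma pow_mul_le_one_sub_sq_rpow_pow {m ε h : ℝ} {k : ℕ} (hm : 1 ≤ m) (hk : (k : ℝ) = 2 * m - 1)
    (hε0 : 0 < ε) (hε1 : ε < 1) (h0 : -1 < h) (h1 : h < 1) :
    (1 - ε) ^ m * (capTail m h ^ k -
      ε / (1 - ε) * (capTail m h ^ (k + 1) / ε ^ m - capTail m h ^ k)) ≤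
      ((1 - h ^ 2) ^ m) ^ k := by
  have hm0 : 0 < m := by linarith
  have hu0 : 0 < 1 - h ^ 2 := by nlinarith
  have hW0 : 0 < (1 - h ^ 2) ^ m := Real.rpow_pos_of_pos hu0 m
  have hWQ := one_sub_sq_rpow_le_capTail hm h0.le h1.le
  have hQ0 : 0 < capTail m h := hW0.trans_le hWQ
  set W := (1 - h ^ 2) ^ m with hW
  set Q := capTail m h with hQ
  have hg0 : 0 < W / Q := by positivity
  have hg1 : W / Q ≤ 1 := (div_le_one hQ0).2 hWQ
  obtain ⟨t, ht0, ht1, htQ, htg⟩ : ∃ t, 0 ≤ t ∧ t ≤ 1 ∧ t ^ m ≤ Q ∧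
      (1 - t) ^ m ≤ (W / Q) ^ (k + 1) := by
    rcases le_total 0 h with hp | hn
    · refine ⟨1 - h ^ 2, hu0.le, by nlinarith, hWQ, ?_⟩
      have e1 : (1 - (1 - h ^ 2)) ^ m = h ^ (k + 1) := by
        rw [sub_sub_cancel, ← Real.rpow_natCast h 2, ← Real.rpow_mul hp,
          ← Real.rpow_natCast h (k + 1)]
        push_cast
        rw [hk]
        ring_nf
      rw [e1]
      refine pow_le_pow_left₀ hp ?_ _
      rw [le_div_iff₀ hQ0]
      exact mul_capTail_le hm hp h1.le
    · refine ⟨1, zero_le_one, le_rfl, ?_, ?_⟩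
      · have e1 := one_sub_sq_rpow_le_capTail (h := 0) hm (by norm_num) (by norm_num)
        have e2 := capTail_antitoneOn hm ⟨h0.le, h1.le⟩
          (show (0 : ℝ) ∈ Set.Icc (-1) 1 by constructor <;> norm_num) hn
        norm_num at e1 ⊢
        linarith
      · rw [sub_self, Real.zero_rpow hm0.ne']
        positivity
  have hA := (tangent_le_one_sub_rpow hm hε0 hε1 ht0 ht1 htQ).trans htg
  have hB : (W / Q) ^ (k + 1) ≤ (W / Q) ^ k :=
    pow_le_pow_of_le_one hg0.le hg1 (Nat.le_succ k)
  have hC := mul_le_mul_of_nonneg_right (hA.trans hB) (pow_nonneg hQ0.le k)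
  rw [div_pow, div_mul_cancel₀ _ (pow_pos hQ0 k).ne'] at hC
  refine le_trans (le_of_eq ?_) hC
  ring

lemma one_sub_sq_rpow_pow_le {m ε h : ℝ} {k : ℕ} (hm : 1 ≤ m) (hk : (k : ℝ) + 1 = 2 * m - 1)
    (hε0 : 0 < ε) (hε1 : ε ≤ 1 / 2) (h0 : -1 < h) (h1 : h < 1) :
    ((1 - h ^ 2) ^ m) ^ (k + 1) ≤ (1 - ε) ^ (m - 1) * (capTail m h ^ (k + 1) +
      ε / (1 - ε) * (3 * ε ^ m) * capTail m h ^ k) := by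
  have hu0 : 0 < 1 - h ^ 2 := by nlinarith
  have hW0 : 0 < (1 - h ^ 2) ^ m := Real.rpow_pos_of_pos hu0 m
  have hQ0 := hW0.trans_le (one_sub_sq_rpow_le_capTail hm h0.le h1.le)
  have hA := rpow_le_of_le_sqrt (u := 1 - h ^ 2) (g := (1 - h ^ 2) ^ m / capTail m h)
    (Q := capTail m h) hm hε0 hε1 hu0 (by nlinarith) (by positivity) hQ0 (by field_simp)
    (by rw [div_le_iff₀ hQ0]; exact one_sub_sq_rpow_le_sqrt_mul_capTail hm h0.le h1.le)
  rw [← hk, ← Nat.cast_succ, Real.rpow_natCast] at hA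
  have hC := mul_le_mul_of_nonneg_right hA (pow_nonneg hQ0.le (k + 1))
  rw [div_pow, Nat.succ_eq_add_one, div_mul_cancel₀ _ (pow_pos hQ0 _).ne'] at hC
  refine hC.trans (le_of_eq ?_)
  have e1 : 3 * ε ^ m / capTail m h * capTail m h ^ (k + 1) = 3 * ε ^ m * capTail m h ^ k := by
    rw [pow_succ]
    field_simp
  linear_combination (1 - ε) ^ (m - 1) * (ε / (1 - ε)) * e1

lemma intervalIntegrable_one_sub_sq_rpow {d : ℕ} (hd : 2 ≤ d) :
    IntervalIntegrable (fun s : ℝ => (1 - s ^ 2) ^ (((d : ℝ) - 3) / 2)) MeasureTheory.volume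
      (-1) 1 := by
  refine intervalIntegral.intervalIntegrable_of_integral_ne_zero fun h => ?_
  have := c1_mul_integral hd
  rw [h, mul_zero] at this
  exact zero_ne_one this

/-- The distribution function of one coordinate of a uniform random point on the sphere. -/
noncomputable def capCdf (d : ℕ) (h : ℝ) : ℝ :=
  c1 d * ∫ s in (-1 : ℝ)..h, (1 - s ^ 2) ^ (((d : ℝ) - 3) / 2)

lemma capCdf_neg_one (d : ℕ) : capCdf d (-1) = 0 := by simp [capCdf]

lemma capCdf_one {d : ℕ} (hd : 2 ≤ d) : capCdf d 1 = 1 := c1_mul_integral hd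

lemma continuousOn_capCdf {d : ℕ} (hd : 2 ≤ d) : ContinuousOn (capCdf d) (Set.uIcc (-1) 1) :=
  continuousOn_const.mul (intervalIntegral.continuousOn_primitive_interval'
    (intervalIntegrable_one_sub_sq_rpow hd) Set.left_mem_uIcc)

lemma hasDerivAt_capCdf {d : ℕ} (hd : 2 ≤ d) {h : ℝ} (hh : h ∈ Set.Ioo (-1 : ℝ) 1) :
    HasDerivAt (capCdf d) (c1 d * (1 - h ^ 2) ^ (((d : ℝ) - 3) / 2)) h := by
  have hm : Measurable fun s : ℝ => (1 - s ^ 2) ^ (((d : ℝ) - 3) / 2) := by fun_prop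
  refine (intervalIntegral.integral_hasDerivAt_right
    ((intervalIntegrable_one_sub_sq_rpow hd).mono_set ?_)
    hm.stronglyMeasurable.stronglyMeasurableAtFilter ?_).const_mul (c1 d)
  · rw [Set.uIcc_of_le hh.1.le, Set.uIcc_of_le (by norm_num)]
    exact Set.Icc_subset_Icc_right hh.2.le
  · refine ContinuousAt.rpow_const (by fun_prop) (Or.inl ?_)
    have : 0 < 1 - h ^ 2 := by nlinarith [hh.1, hh.2]
    exact this.ne'

lemma integral_capCdf_moment {d : ℕ} (hd : 2 ≤ d) (j k : ℕ) :
    ∫ h in (-1 : ℝ)..1, (1 - capCdf d h) ^ j * capCdf d h ^ k *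
      (c1 d * (1 - h ^ 2) ^ (((d : ℝ) - 3) / 2)) =
      (j.factorial : ℝ) * k.factorial / (j + k + 1).factorial := by
  have hc := continuousOn_capCdf hd
  have h1 := intervalIntegral.integral_comp_mul_deriv''' (a := -1) (b := 1) (f := capCdf d)
    (f' := fun h => c1 d * (1 - h ^ 2) ^ (((d : ℝ) - 3) / 2))
    (g := fun x => (1 - x) ^ j * x ^ k) hc ?_ ?_ ?_ ?_
  · rw [capCdf_neg_one, capCdf_one hd, integral_pow_mul_one_sub_pow] at h1
    exact h1
  · intro x hx
    rw [min_eq_left (by norm_num), max_eq_right (by norm_num)] at hx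
    exact (hasDerivAt_capCdf hd hx).hasDerivWithinAt
  · fun_prop
  · exact ContinuousOn.integrableOn_compact (isCompact_uIcc.image_of_continuousOn hc)
      (by fun_prop)
  · refine MeasureTheory.IntegrableOn.continuousOn_mul ?_ ?_ isCompact_uIcc
    · exact ((continuousOn_const.sub hc).pow j).mul (hc.pow k)
    · have := (intervalIntegrable_one_sub_sq_rpow hd).const_mul (c1 d)
      rw [intervalIntegrable_iff'] at this
      exact this

lemma one_sub_capCdf {d : ℕ} (hd : 3 ≤ d) (h : ℝ) :
    1 - capCdf d h = capTail (((d : ℝ) - 1) / 2) h / (((d : ℝ) - 1) / c1 d) := by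
  have hd' : (3 : ℝ) ≤ d := by exact_mod_cast hd
  have hc := continuous_one_sub_sq_rpow (r := ((d : ℝ) - 3) / 2) (by linarith)
  have h1 := intervalIntegral.integral_add_adjacent_intervals
    (hc.intervalIntegrable (μ := MeasureTheory.volume) (-1) h) (hc.intervalIntegrable h 1)
  have h2 := c1_mul_integral (d := d) (by omega)
  have h3 := c1_pos (d := d) (by omega)
  rw [← h1, mul_add] at h2
  rw [capCdf, capTail, show ((d : ℝ) - 1) / 2 - 1 = ((d : ℝ) - 3) / 2 by ring,
    ← eq_sub_iff_add_eq'.2 h2]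
  have h4 : (d : ℝ) - 1 ≠ 0 := by linarith
  field_simp

lemma II_eq {n d : ℕ} (hd : 2 ≤ d) :
    II n d (-1) 1 = (((d : ℝ) - 1) / c1 d) ^ (d - 2) / c1 d *
      ∫ h in (-1 : ℝ)..1, ((1 - h ^ 2) ^ (((d : ℝ) - 1) / 2) / (((d : ℝ) - 1) / c1 d)) ^ (d - 2) *
        capCdf d h ^ (n - d) * (c1 d * (1 - h ^ 2) ^ (((d : ℝ) - 3) / 2)) := by
  have hc1 := c1_pos hd
  have hd' : (2 : ℝ) ≤ d := by exact_mod_cast hd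
  have hd1 : 0 < (d : ℝ) - 1 := by linarith
  rw [II, ← intervalIntegral.integral_const_mul]
  refine intervalIntegral.integral_congr_Ioo_of_le (by norm_num) fun h hh => ?_
  have hu : 0 < 1 - h ^ 2 := by nlinarith [hh.1, hh.2]
  have e1 : (1 - h ^ 2) ^ (((d : ℝ) ^ 2 - 2 * d - 1) / 2) =
      ((1 - h ^ 2) ^ (((d : ℝ) - 1) / 2)) ^ (d - 2) * (1 - h ^ 2) ^ (((d : ℝ) - 3) / 2) := by
    rw [← Real.rpow_natCast _ (d - 2), ← Real.rpow_mul hu.le, ← Real.rpow_add hu, Nat.cast_sub hd]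
    congr 1
    push_cast
    ring
  simp only [e1]
  rw [div_pow _ (((d : ℝ) - 1) / c1 d), capCdf]
  have hA : 0 < (((d : ℝ) - 1) / c1 d) ^ (d - 2) := by positivity
  field_simp

lemma Kd_eq {d : ℕ} (hd : 2 ≤ d) :
    Kd d = 2 * c2 d / (c1 d * d * ((d : ℝ) - 1)) * (((d : ℝ) - 1) / c1 d) ^ (d - 2) := by
  obtain ⟨k, rfl⟩ := Nat.exists_eq_add_of_le' hd
  have hs := Real.sqrt_pos.2 Real.pi_pos
  have e1 : Real.pi ^ (((k + 2 : ℕ) : ℝ) / 2 - 1) = Real.sqrt Real.pi ^ k := by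
    rw [Real.sqrt_eq_rpow, ← Real.rpow_natCast, ← Real.rpow_mul Real.pi_pos.le]
    congr 1
    push_cast
    ring
  have hY : 0 < Real.Gamma ((((k + 2 : ℕ) : ℝ) - 1) / 2) :=
    Real.Gamma_pos_of_pos (by push_cast; linarith [k.cast_nonneg (α := ℝ)])
  have hX : 0 < Real.Gamma (((k + 2 : ℕ) : ℝ) / 2) := Real.Gamma_pos_of_pos (by positivity)
  have e2 : Real.Gamma ((((k + 2 : ℕ) : ℝ) + 1) / 2) =
      ((k : ℝ) + 1) / 2 * Real.Gamma ((((k + 2 : ℕ) : ℝ) - 1) / 2) := by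
    have h := Real.Gamma_add_one (s := (((k + 2 : ℕ) : ℝ) - 1) / 2)
      (by push_cast; linarith [k.cast_nonneg (α := ℝ)])
    rw [show (((k + 2 : ℕ) : ℝ) - 1) / 2 + 1 = (((k + 2 : ℕ) : ℝ) + 1) / 2 by ring] at h
    rw [h]
    push_cast
    ring
  have hR2 : 0 < Real.Gamma ((((k + 2 : ℕ) : ℝ) ^ 2 - 2 * ((k + 2 : ℕ) : ℝ) + 1) / 2) :=
    Real.Gamma_pos_of_pos (by push_cast; nlinarith [k.cast_nonneg (α := ℝ)])
  rw [Kd, c2, c1, e1, e2, Nat.add_sub_cancel, show k + 2 - 1 = k + 1 by omega]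
  generalize Real.Gamma ((((k + 2 : ℕ) : ℝ) - 1) / 2) = Y at *
  generalize Real.Gamma (((k + 2 : ℕ) : ℝ) / 2) = X at *
  generalize Real.Gamma ((((k + 2 : ℕ) : ℝ) ^ 2 - 2 * ((k + 2 : ℕ) : ℝ) + 1) / 2) = R2 at *
  generalize Real.Gamma ((((k + 2 : ℕ) : ℝ) ^ 2 - 2 * ((k + 2 : ℕ) : ℝ) + 2) / 2) = R1 at *
  generalize Real.sqrt Real.pi = S at *
  have h1 : (((k + 2 : ℕ) : ℝ) - 1) = (k : ℝ) + 1 := by push_cast; ring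
  have hk : (0 : ℝ) < (k : ℝ) + 1 := by positivity
  have hk2 : (0 : ℝ) < ((k + 2 : ℕ) : ℝ) := by positivity
  rw [h1]
  generalize ((k + 2 : ℕ) : ℝ) = D at *
  generalize (k : ℝ) + 1 = T at *
  simp only [div_pow, mul_pow, pow_succ]
  field_simp

lemma Kd_pos {d : ℕ} (hd : 2 ≤ d) : 0 < Kd d := by
  have hc1 := c1_pos hd
  have hd' : (2 : ℝ) ≤ d := by exact_mod_cast hd
  have hd1 : 0 < (d : ℝ) - 1 := by linarith
  have hc2 : 0 < c2 d := by
    have := Real.sqrt_pos.2 Real.pi_pos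
    have h1 := Real.Gamma_pos_of_pos (show 0 < ((d : ℝ) ^ 2 - 2 * d + 2) / 2 by nlinarith)
    have h2 := Real.Gamma_pos_of_pos (show 0 < ((d : ℝ) ^ 2 - 2 * d + 1) / 2 by nlinarith)
    unfold c2
    positivity
  rw [Kd_eq hd]
  positivity

lemma FF_eq {n d : ℕ} (hd : 2 ≤ d) (hdn : d < n) :
    FF n d (-1) 1 = n * Kd d *
      ((∫ h in (-1 : ℝ)..1,
        ((1 - h ^ 2) ^ (((d : ℝ) - 1) / 2) / (((d : ℝ) - 1) / c1 d)) ^ (d - 2) *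
        capCdf d h ^ (n - d) * (c1 d * (1 - h ^ 2) ^ (((d : ℝ) - 3) / 2))) /
      ((d - 2).factorial * (n - d).factorial / (n - 1).factorial : ℝ)) := by
  have hc1 := c1_pos hd
  have hd' : (2 : ℝ) ≤ d := by exact_mod_cast hd
  have hd1 : 0 < (d : ℝ) - 1 := by linarith
  rw [FF, II_eq hd, Kd_eq hd]
  generalize (∫ h in (-1 : ℝ)..1,
        ((1 - h ^ 2) ^ (((d : ℝ) - 1) / 2) / (((d : ℝ) - 1) / c1 d)) ^ (d - 2) *
        capCdf d h ^ (n - d) * (c1 d * (1 - h ^ 2) ^ (((d : ℝ) - 3) / 2))) = E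
  have hchoose : (n.choose d : ℝ) * ((d - 2).factorial * (n - d).factorial) * (d * ((d : ℝ) - 1)) =
      n * (n - 1).factorial := by
    have h1 := Nat.choose_mul_factorial_mul_factorial hdn.le
    have h2 : d.factorial = d * ((d - 1) * (d - 2).factorial) := by
      obtain ⟨k, rfl⟩ := Nat.exists_eq_add_of_le' hd
      rfl
    have h3 : n.factorial = n * (n - 1).factorial := (Nat.mul_factorial_pred (by omega)).symm
    rw [h2, h3] at h1
    have h4 : ((d - 1 : ℕ) : ℝ) = (d : ℝ) - 1 := by
      rw [Nat.cast_sub (by omega)]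
      norm_num
    rw [← h4]
    norm_cast
    rw [← h1]
    ring
  have hA : 0 < (((d : ℝ) - 1) / c1 d) ^ (d - 2) := by positivity
  generalize (((d : ℝ) - 1) / c1 d) ^ (d - 2) = A at *
  have f1 : (0 : ℝ) < (d - 2).factorial := by positivity
  have f2 : (0 : ℝ) < (n - d).factorial := by positivity
  field_simp
  linear_combination (c2 d * E) * hchoose

lemma eps_rpow_half {n d : ℕ} (hd : 2 ≤ d) :
    ((d : ℝ) ^ (3 / ((d : ℝ) - 1)) * (n : ℝ) ^ (-2 / ((d : ℝ) - 1))) ^ (((d : ℝ) - 1) / 2) =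
      (d : ℝ) ^ (3 / 2 : ℝ) / n := by
  have hd' : (2 : ℝ) ≤ d := by exact_mod_cast hd
  have hd1 : (d : ℝ) - 1 ≠ 0 := by linarith
  have e1 : 3 / ((d : ℝ) - 1) * (((d : ℝ) - 1) / 2) = 3 / 2 := by field_simp
  have e2 : -2 / ((d : ℝ) - 1) * (((d : ℝ) - 1) / 2) = -1 := by field_simp
  rw [Real.mul_rpow (by positivity) (by positivity), ← Real.rpow_mul (by positivity),
    ← Real.rpow_mul (by positivity), e1, e2, Real.rpow_neg_one, ← div_eq_mul_inv]

lemma rpow_three_halves_sq (d : ℕ) : ((d : ℝ) ^ (3 / 2 : ℝ)) ^ 2 = (d : ℝ) ^ 3 := by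
  rw [← Real.rpow_natCast, ← Real.rpow_mul (by positivity), ← Real.rpow_natCast]
  norm_num

lemma sq_sub_one_le_c1 {d : ℕ} (hd : 3 ≤ d) :
    ((d : ℝ) - 1) ^ 2 ≤ 4 * (c1 d * (d : ℝ) ^ (3 / 2 : ℝ)) := by
  have hd' : (3 : ℝ) ≤ d := by exact_mod_cast hd
  have hc1 := c1_pos (d := d) (by omega)
  refine abs_le_of_sq_le_sq' ?_ (by positivity) |>.2
  rw [mul_pow, mul_pow, rpow_three_halves_sq]
  have h1 := le_c1_sq hd
  have h2 : ((d : ℝ) - 2) / 2 ≤ c1 d ^ 2 * 4 :=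
    h1.trans (mul_le_mul_of_nonneg_left Real.pi_le_four (by positivity))
  have h3 : ((d : ℝ) - 1) ^ 3 ≤ (d : ℝ) ^ 3 := pow_le_pow_left₀ (by linarith) (by linarith) 3
  have h4 : 0 < (d : ℝ) ^ 3 := by positivity
  have h5 : ((d : ℝ) - 1) ≤ 16 * c1 d ^ 2 := by linarith
  calc (((d : ℝ) - 1) ^ 2) ^ 2 = ((d : ℝ) - 1) ^ 3 * ((d : ℝ) - 1) := by ring
    _ ≤ (d : ℝ) ^ 3 * (16 * c1 d ^ 2) := by
        apply mul_le_mul h3 h5 (by linarith) h4.le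
    _ = _ := by ring

lemma c1_mul_le {d : ℕ} (hd : 3 ≤ d) :
    c1 d * (d : ℝ) ^ (3 / 2 : ℝ) ≤ 4 * (((d : ℝ) - 1) * ((d : ℝ) - 2)) := by
  have hd' : (3 : ℝ) ≤ d := by exact_mod_cast hd
  have hd1 : 0 < (d : ℝ) - 1 := by linarith
  have hd2 : 0 < (d : ℝ) - 2 := by linarith
  have hc1 := c1_pos (d := d) (by omega)
  refine abs_le_of_sq_le_sq' ?_ (by positivity) |>.2
  rw [mul_pow, mul_pow, rpow_three_halves_sq]
  have h1 := c1_sq_le (d := d) (by omega)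
  have h2 : c1 d ^ 2 * 3 ≤ ((d : ℝ) - 1) / 2 :=
    (mul_le_mul_of_nonneg_left Real.pi_gt_three.le (by positivity)).trans h1
  have h3 : (d : ℝ) ^ 2 ≤ (3 * ((d : ℝ) - 2)) ^ 2 :=
    pow_le_pow_left₀ (by linarith) (by linarith) 2
  have h4 : (d : ℝ) ≤ 2 * ((d : ℝ) - 1) := by linarith
  have h5 : (d : ℝ) ^ 3 ≤ 2 * ((d : ℝ) - 1) * (3 * ((d : ℝ) - 2)) ^ 2 := by
    calc (d : ℝ) ^ 3 = d * (d : ℝ) ^ 2 := by ring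
      _ ≤ _ := by gcongr
  calc c1 d ^ 2 * (d : ℝ) ^ 3
      ≤ (((d : ℝ) - 1) / 6) * (2 * ((d : ℝ) - 1) * (3 * ((d : ℝ) - 2)) ^ 2) := by
        gcongr
        linarith
    _ = 3 * (((d : ℝ) - 1) * ((d : ℝ) - 2)) ^ 2 := by ring
    _ ≤ _ := by rw [mul_pow]; nlinarith [sq_nonneg (((d : ℝ) - 1) * ((d : ℝ) - 2))]

lemma capCdf_nonneg {d : ℕ} (hd : 3 ≤ d) {h : ℝ} (hh : h ∈ Set.Ioo (-1 : ℝ) 1) :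
    0 ≤ capCdf d h := by
  have hc1 := c1_pos (d := d) (by omega)
  refine mul_nonneg hc1.le (intervalIntegral.integral_nonneg hh.1.le fun s hs => ?_)
  exact Real.rpow_nonneg (one_sub_sq_nonneg hs.1 (hs.2.trans hh.2.le)) _

lemma normalized_integral_bounds {k N : ℕ} {ε : ℝ} (hε0 : 0 < ε) (hε1 : ε ≤ 1 / 2)
    (hε : ε ^ ((((k + 3 : ℕ) : ℝ) - 1) / 2) = ((k + 3 : ℕ) : ℝ) ^ (3 / 2 : ℝ) / (k + 3 + N : ℕ))
    {E B : ℝ}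
    (hE : E = ∫ h in (-1 : ℝ)..1, ((1 - h ^ 2) ^ ((((k + 3 : ℕ) : ℝ) - 1) / 2) /
        ((((k + 3 : ℕ) : ℝ) - 1) / c1 (k + 3))) ^ (k + 1) * capCdf (k + 3) h ^ N *
        (c1 (k + 3) * (1 - h ^ 2) ^ ((((k + 3 : ℕ) : ℝ) - 3) / 2)))
    (hB : B = ((k + 1).factorial : ℝ) * N.factorial / (k + 1 + N + 1).factorial) :
    (1 - ε) ^ ((((k + 3 : ℕ) : ℝ) - 1) / 2) * (1 - 4 * (ε / (1 - ε))) * B ≤ E ∧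
    E ≤ (1 - ε) ^ ((((k + 3 : ℕ) : ℝ) - 1) / 2 - 1) * (1 + 12 * (ε / (1 - ε))) * B := by
  have hd : 3 ≤ k + 3 := by omega
  have hd2 : 2 ≤ k + 3 := by omega
  have hc1 := c1_pos hd2
  have hlow := sq_sub_one_le_c1 hd
  have hup := c1_mul_le hd
  have hM := integral_capCdf_moment hd2
  have hcdf := continuousOn_capCdf hd2
  have hPQ := one_sub_capCdf hd
  have hF := fun h (hh : h ∈ Set.Ioo (-1 : ℝ) 1) => capCdf_nonneg hd hh
  have hk0 : (0 : ℝ) ≤ k := k.cast_nonneg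
  have hcast : ((k + 3 : ℕ) : ℝ) = (k : ℝ) + 3 := by push_cast; ring
  have hm : 1 ≤ (((k + 3 : ℕ) : ℝ) - 1) / 2 := by rw [hcast]; linarith
  have hkm : ((k + 1 : ℕ) : ℝ) = 2 * ((((k + 3 : ℕ) : ℝ) - 1) / 2) - 1 := by push_cast; ring
  have hw : ContinuousOn (fun h : ℝ => capCdf (k + 3) h ^ N *
      (c1 (k + 3) * (1 - h ^ 2) ^ ((((k + 3 : ℕ) : ℝ) - 3) / 2))) (Set.uIcc (-1) 1) :=
    (hcdf.pow N).mul (continuous_const.mul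
      (continuous_one_sub_sq_rpow (by rw [hcast]; linarith))).continuousOn
  have hWc := continuous_one_sub_sq_rpow (r := (((k + 3 : ℕ) : ℝ) - 1) / 2) (by linarith)
  have hw0 : ∀ h ∈ Set.Ioo (-1 : ℝ) 1, 0 ≤ capCdf (k + 3) h ^ N *
      (c1 (k + 3) * (1 - h ^ 2) ^ ((((k + 3 : ℕ) : ℝ) - 3) / 2)) := fun h hh =>
    mul_nonneg (pow_nonneg (hF h hh) N)
      (mul_nonneg hc1.le (Real.rpow_nonneg (one_sub_sq_nonneg hh.1.le hh.2.le) _))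
  set c := c1 (k + 3) with hc
  set F := capCdf (k + 3) with hFdef
  set m := (((k + 3 : ℕ) : ℝ) - 1) / 2 with hmdef
  set A := (((k + 3 : ℕ) : ℝ) - 1) / c with hA
  have hA0 : 0 < A := div_pos (by rw [hcast]; linarith) hc1
  set D := ((k + 3 : ℕ) : ℝ) ^ (3 / 2 : ℝ) with hDdef
  have hD0 : 0 < D := by positivity
  set κ := ε / (1 - ε) with hκ
  have h1ε : 0 < 1 - ε := by linarith
  have hκ0 : 0 < κ := by positivity
  have hint : ∀ j : ℕ, IntervalIntegrable (fun h => (1 - F h) ^ j * F h ^ N *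
      (c * (1 - h ^ 2) ^ ((((k + 3 : ℕ) : ℝ) - 3) / 2))) MeasureTheory.volume (-1) 1 := fun j => by
    simp only [mul_assoc ((1 - F _) ^ j)]
    exact (((continuousOn_const.sub hcdf).pow j).mul hw).intervalIntegrable
  have hEint : IntervalIntegrable (fun h => ((1 - h ^ 2) ^ m / A) ^ (k + 1) * F h ^ N *
      (c * (1 - h ^ 2) ^ ((((k + 3 : ℕ) : ℝ) - 3) / 2))) MeasureTheory.volume (-1) 1 := by
    simp only [mul_assoc ((_ / A) ^ (k + 1))]
    exact ((hWc.div_const A).pow (k + 1)).continuousOn.mul hw |>.intervalIntegrable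
  have hB0 : 0 < B := by rw [hB]; positivity
  have hM1 : ((k + 1).factorial : ℝ) * N.factorial / (k + 1 + N + 1).factorial = B := hB.symm
  have hM2 : ((k + 2).factorial : ℝ) * N.factorial / (k + 2 + N + 1).factorial =
      (k + 2) / (k + 3 + N) * B := by
    rw [hB, show k + 2 + N + 1 = (k + 1 + N + 1) + 1 by ring, Nat.factorial_succ (k + 1),
      Nat.factorial_succ (k + 1 + N + 1)]
    push_cast
    field_simp
    ring
  have hM0 : (k.factorial : ℝ) * N.factorial / (k + N + 1).factorial =
      (k + N + 2) / (k + 1) * B := by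
    rw [hB, show k + 1 + N + 1 = (k + N + 1) + 1 by ring, Nat.factorial_succ k,
      Nat.factorial_succ (k + N + 1)]
    push_cast
    field_simp
    ring
  have hεm : ε ^ m = D / (k + 3 + N) := by rw [hε]; push_cast; ring
  have hεm0 : 0 < ε ^ m := Real.rpow_pos_of_pos hε0 m
  rw [hcast, show (k : ℝ) + 3 - 1 = k + 2 by ring] at hlow
  rw [hcast, show (k : ℝ) + 3 - 1 = k + 2 by ring, show (k : ℝ) + 3 - 2 = k + 1 by ring] at hup
  have hA' : A = (k + 2) / c := by rw [hA, hcast]; ring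
  constructor
  · have hstep : (1 - ε) ^ m * (B - κ * (A / ε ^ m * ((k + 2) / (k + 3 + N) * B) - B)) ≤ E := by
      have e1 : ∫ h in (-1 : ℝ)..1, (1 - ε) ^ m *
          (((1 - F h) ^ (k + 1) * F h ^ N *
            (c * (1 - h ^ 2) ^ ((((k + 3 : ℕ) : ℝ) - 3) / 2))) -
          κ * (A / ε ^ m * ((1 - F h) ^ (k + 2) * F h ^ N *
            (c * (1 - h ^ 2) ^ ((((k + 3 : ℕ) : ℝ) - 3) / 2))) -
            ((1 - F h) ^ (k + 1) * F h ^ N *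
            (c * (1 - h ^ 2) ^ ((((k + 3 : ℕ) : ℝ) - 3) / 2))))) =
          (1 - ε) ^ m * (B - κ * (A / ε ^ m * ((k + 2) / (k + 3 + N) * B) - B)) := by
        rw [intervalIntegral.integral_const_mul, intervalIntegral.integral_sub (hint _)
          ((((hint _).const_mul _).sub (hint _)).const_mul _), intervalIntegral.integral_const_mul,
          intervalIntegral.integral_sub ((hint _).const_mul _) (hint _),
          intervalIntegral.integral_const_mul, hM, hM, hM1, hM2]
      rw [← e1, hE]
      refine intervalIntegral.integral_mono_on_of_le_Ioo (by norm_num)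
        (((hint _).sub ((((hint _).const_mul _).sub (hint _)).const_mul _)).const_mul _) hEint
        fun h hh => ?_
      have h1 := pow_mul_le_one_sub_sq_rpow_pow hm hkm hε0 (by linarith) hh.1 hh.2
      rw [← hκ] at h1
      have h2 := mul_le_mul_of_nonneg_right
        (div_le_div_of_nonneg_right h1 (pow_pos hA0 (k + 1)).le) (hw0 h hh)
      rw [← div_pow] at h2
      rw [mul_assoc ((_ / A) ^ (k + 1))]
      refine le_trans (le_of_eq ?_) h2
      rw [hPQ h]
      simp only [div_pow, pow_succ _ (k + 1)]
      have hAk := pow_pos hA0 (k + 1)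
      field_simp
    refine le_trans ?_ hstep
    rw [mul_assoc]
    refine mul_le_mul_of_nonneg_left ?_ (Real.rpow_nonneg h1ε.le m)
    have e2 : A / ε ^ m * ((k + 2) / (k + 3 + N)) ≤ 4 := by
      rw [hεm, hA']
      have : ((k : ℝ) + 2) / c / (D / (k + 3 + N)) * ((k + 2) / (k + 3 + N)) =
          (k + 2) ^ 2 / (c * D) := by
        field_simp
      rw [this, div_le_iff₀ (by positivity)]
      exact hlow
    have e3 := mul_le_mul_of_nonneg_right e2 (mul_pos hκ0 hB0).le
    nlinarith [mul_pos hκ0 hB0]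
  · have hstep : E ≤ (1 - ε) ^ (m - 1) *
        (B + κ * (3 * ε ^ m) / A * ((k + N + 2) / (k + 1) * B)) := by
      have e1 : ∫ h in (-1 : ℝ)..1, (1 - ε) ^ (m - 1) *
          (((1 - F h) ^ (k + 1) * F h ^ N *
            (c * (1 - h ^ 2) ^ ((((k + 3 : ℕ) : ℝ) - 3) / 2))) +
          κ * (3 * ε ^ m) / A * ((1 - F h) ^ k * F h ^ N *
            (c * (1 - h ^ 2) ^ ((((k + 3 : ℕ) : ℝ) - 3) / 2)))) =
          (1 - ε) ^ (m - 1) *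
            (B + κ * (3 * ε ^ m) / A * ((k + N + 2) / (k + 1) * B)) := by
        rw [intervalIntegral.integral_const_mul, intervalIntegral.integral_add (hint _)
          ((hint _).const_mul _), intervalIntegral.integral_const_mul, hM, hM, hM1, hM0]
      rw [← e1, hE]
      refine intervalIntegral.integral_mono_on_of_le_Ioo (by norm_num) hEint
        (((hint _).add ((hint _).const_mul _)).const_mul _)
        fun h hh => ?_
      have h1 := one_sub_sq_rpow_pow_le hm (k := k) (by rw [← hkm]; push_cast; ring)
        hε0 hε1 hh.1 hh.2
      rw [← hκ] at h1
      have h2 := mul_le_mul_of_nonneg_right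
        (div_le_div_of_nonneg_right h1 (pow_pos hA0 (k + 1)).le) (hw0 h hh)
      rw [← div_pow] at h2
      rw [mul_assoc ((_ / A) ^ (k + 1))]
      refine h2.trans (le_of_eq ?_)
      rw [hPQ h]
      simp only [div_pow, pow_succ A k]
      have hAk := pow_pos hA0 k
      field_simp
    refine hstep.trans ?_
    rw [mul_assoc]
    refine mul_le_mul_of_nonneg_left ?_ (Real.rpow_nonneg h1ε.le _)
    have e2 : ε ^ m / A * ((k + N + 2) / (k + 1)) ≤ 4 := by
      rw [hεm, hA']
      have : D / (k + 3 + N) / (((k : ℝ) + 2) / c) * ((k + N + 2) / (k + 1)) =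
          (c * D) / ((k + 2) * (k + 1)) * ((k + N + 2) / (k + 3 + N)) := by
        field_simp
      rw [this]
      refine (mul_le_of_le_one_right (by positivity) ?_).trans ?_
      · rw [div_le_one (by positivity)]
        linarith
      · rw [div_le_iff₀ (by positivity)]
        exact hup
    have e3 := mul_le_mul_of_nonneg_right e2 (mul_pos hκ0 hB0).le
    have e4 : κ * (3 * ε ^ m) / A * ((k + N + 2) / (k + 1) * B) =
      3 * (ε ^ m / A * ((k + N + 2) / (k + 1)) * (κ * B)) := by ring
    rw [e4]
    linarith

lemma FF_ratio_bounds {n d : ℕ} (hd : 2 ≤ d) (hdn : d < n) {ε : ℝ}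
    (hε : ε = (d : ℝ) ^ (3 / ((d : ℝ) - 1)) * (n : ℝ) ^ (-2 / ((d : ℝ) - 1)))
    (hε1 : ε ≤ 1 / 2) :
    1 - 4 * (ε / (1 - ε)) ≤ FF n d (-1) 1 / (n * Kd d * hstar n d ^ (d - 1)) ∧
    FF n d (-1) 1 / (n * Kd d * hstar n d ^ (d - 1)) ≤ (1 + 12 * (ε / (1 - ε))) / (1 - ε) := by
  have hd' : (2 : ℝ) ≤ d := by exact_mod_cast hd
  have hd0 : (0 : ℝ) < d := by linarith
  have hn0 : (0 : ℝ) < n := by exact_mod_cast (by omega : 0 < n)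
  have hε0 : 0 < ε := by rw [hε]; positivity
  have h1ε : 0 < 1 - ε := by linarith
  have hκ : 0 < ε / (1 - ε) := by positivity
  have hK := Kd_pos hd
  have hstar_pow : hstar n d ^ (d - 1) = (1 - ε) ^ (((d : ℝ) - 1) / 2) := by
    rw [hstar, ← hε, Real.sqrt_eq_rpow, ← Real.rpow_natCast, ← Real.rpow_mul h1ε.le,
      Nat.cast_sub (by omega)]
    congr 1
    push_cast
    ring
  have hpow := Real.rpow_pos_of_pos h1ε (((d : ℝ) - 1) / 2)
  rw [hstar_pow, FF_eq hd hdn, mul_div_mul_left _ _ (by positivity)]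
  rcases hd.eq_or_lt with h2 | h3
  · have hM := integral_capCdf_moment (d := d) hd 0 (n - d)
    have e0 : d - 2 = 0 := by omega
    have e1 : n - 1 = 0 + (n - d) + 1 := by omega
    simp only [e0, pow_zero, e1] at hM ⊢
    rw [hM, div_self (by positivity)]
    have hexp : ((d : ℝ) - 1) / 2 = 1 / 2 := by rw [← h2]; norm_num
    rw [hexp] at hpow ⊢
    have hle1 : (1 - ε) ^ (1 / 2 : ℝ) ≤ 1 := Real.rpow_le_one h1ε.le (by linarith) (by norm_num)
    have hle2 : 1 - ε ≤ (1 - ε) ^ (1 / 2 : ℝ) := by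
      conv_lhs => rw [← Real.rpow_one (1 - ε)]
      exact Real.rpow_le_rpow_of_exponent_ge h1ε (by linarith) (by norm_num)
    constructor
    · rw [le_div_iff₀ hpow]
      nlinarith
    · gcongr
      linarith
  · obtain ⟨k, rfl⟩ := Nat.exists_eq_add_of_le' (show 3 ≤ d by omega)
    obtain ⟨N, rfl⟩ := Nat.exists_eq_add_of_le hdn.le
    have hεm := eps_rpow_half (n := k + 3 + N) hd
    rw [← hε] at hεm
    obtain ⟨hl, hu⟩ := normalized_integral_bounds hε0 hε1 hεm rfl rfl
    rw [show k + 3 - 2 = k + 1 by omega, show k + 3 + N - (k + 3) = N by omega,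
      show k + 3 + N - 1 = k + 1 + N + 1 by omega]
    have hB : (0 : ℝ) < ((k + 1).factorial : ℝ) * N.factorial / (k + 1 + N + 1).factorial := by
      positivity
    constructor
    · rw [le_div_iff₀ hpow, le_div_iff₀ hB]
      linarith
    · rw [div_le_iff₀ hpow, div_le_iff₀ hB]
      refine hu.trans (le_of_eq ?_)
      rw [Real.rpow_sub_one h1ε.ne']
      ring

lemma eps_pos_le {n d : ℕ} (hd : 2 ≤ d) (hn : 1 ≤ n) :
    0 < (d : ℝ) ^ (3 / ((d : ℝ) - 1)) * (n : ℝ) ^ (-2 / ((d : ℝ) - 1)) ∧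
    (d : ℝ) ^ (3 / ((d : ℝ) - 1)) * (n : ℝ) ^ (-2 / ((d : ℝ) - 1)) ≤
      8 * Real.exp (-2 * (Real.log n / d)) := by
  have hd' : (2 : ℝ) ≤ d := by exact_mod_cast hd
  have hn' : (1 : ℝ) ≤ n := by exact_mod_cast hn
  have hn0 : (0 : ℝ) < n := by linarith
  have hd1 : 0 < (d : ℝ) - 1 := by linarith
  refine ⟨by positivity, mul_le_mul ?_ ?_ (by positivity) (by norm_num)⟩
  · have h1 : d ≤ 2 ^ (d - 1) := by
      have := Nat.lt_two_pow_self (n := d - 1)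
      omega
    have h2 : (d : ℝ) ≤ (2 : ℝ) ^ ((d : ℝ) - 1) := by
      have h3 : (d : ℝ) ≤ (2 : ℝ) ^ (d - 1) := by exact_mod_cast h1
      rwa [← Real.rpow_natCast, Nat.cast_sub (by omega), Nat.cast_one] at h3
    calc (d : ℝ) ^ (3 / ((d : ℝ) - 1))
        ≤ ((2 : ℝ) ^ ((d : ℝ) - 1)) ^ (3 / ((d : ℝ) - 1)) :=
          Real.rpow_le_rpow (by linarith) h2 (by positivity)
      _ = 8 := by
          rw [← Real.rpow_mul (by norm_num), mul_div_cancel₀ _ hd1.ne']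
          norm_num
  · rw [Real.rpow_def_of_pos hn0, Real.exp_le_exp]
    have h1 : Real.log n / d ≤ Real.log n / ((d : ℝ) - 1) :=
      div_le_div_of_nonneg_left (Real.log_nonneg hn') hd1 (by linarith)
    have h2 : Real.log n * (-2 / ((d : ℝ) - 1)) = -2 * (Real.log n / ((d : ℝ) - 1)) := by ring
    linarith

lemma hstar_pow_mem {n d : ℕ} {ε : ℝ} (hε0 : 0 ≤ ε) (hε1 : ε ≤ 1)
    (hε : ε = (d : ℝ) ^ (3 / ((d : ℝ) - 1)) * (n : ℝ) ^ (-2 / ((d : ℝ) - 1))) :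
    1 - d * ε ≤ hstar n d ^ (d - 1) ∧ hstar n d ^ (d - 1) ≤ 1 := by
  rw [hstar, ← hε]
  have h1 : 1 - ε ≤ √(1 - ε) := Real.le_sqrt_of_sq_le (by nlinarith)
  have h2 : √(1 - ε) ≤ 1 := Real.sqrt_le_one.2 (by linarith)
  refine ⟨?_, pow_le_one₀ (Real.sqrt_nonneg _) h2⟩
  have h3 := one_add_mul_le_pow (a := -ε) (by linarith) (d - 1)
  have h4 := pow_le_pow_left₀ (by linarith) h1 (d - 1)
  have h5 : ((d - 1 : ℕ) : ℝ) ≤ d := by exact_mod_cast Nat.sub_le d 1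
  have h6 := mul_le_mul_of_nonneg_right h5 hε0
  rw [← sub_eq_add_neg] at h3
  linarith

lemma mul_rescale_tendsto_zero {d : ℕ → ℕ} (hd : ∀ᶠ n in atTop, 2 ≤ d n ∧ d n < n)
    (hln : Tendsto (fun n : ℕ => Real.log n / (d n : ℝ)) atTop atTop)
    (hlog : Tendsto (fun n : ℕ => Real.log n / ((d n : ℝ) * Real.log (d n))) atTop atTop) :
    Tendsto (fun n : ℕ => (d n : ℝ) * ((d n : ℝ) ^ (3 / ((d n : ℝ) - 1)) *
      (n : ℝ) ^ (-2 / ((d n : ℝ) - 1)))) atTop (nhds 0) := by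
  have hlim : Tendsto (fun n : ℕ => 8 * Real.exp (-(Real.log n / (d n : ℝ)))) atTop (nhds 0) := by
    simpa using (Real.tendsto_exp_neg_atTop_nhds_zero.comp hln).const_mul 8
  refine tendsto_of_tendsto_of_tendsto_of_le_of_le' tendsto_const_nhds hlim ?_ ?_
  · exact Eventually.of_forall fun n => by positivity
  · filter_upwards [hd, hlog.eventually_ge_atTop 1] with n hn hR
    have hd' : (2 : ℝ) ≤ d n := by exact_mod_cast hn.1
    have hd0 : (0 : ℝ) < d n := by linarith
    have hl0 : 0 < Real.log (d n) := Real.log_pos (by linarith)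
    have hld : Real.log (d n) ≤ Real.log n / d n := by
      rw [le_div_iff₀ (by positivity)] at hR ⊢
      linarith
    calc (d n : ℝ) * ((d n : ℝ) ^ (3 / ((d n : ℝ) - 1)) * (n : ℝ) ^ (-2 / ((d n : ℝ) - 1)))
        ≤ Real.exp (Real.log n / d n) * (8 * Real.exp (-2 * (Real.log n / d n))) := by
          refine mul_le_mul ?_ (eps_pos_le hn.1 (by omega)).2 (by positivity) (by positivity)
          rw [← Real.log_le_iff_le_exp hd0]
          exact hld
      _ = 8 * Real.exp (-(Real.log n / d n)) := by
          rw [mul_left_comm, ← Real.exp_add]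
          ring_nf

/-- in the superexponential regime `(ln n)/d → ∞`,
`F ∼ n·K_d·h_*^{d-1}`; if moreover `ln n ≫ d ln d`, then `F ∼ n·K_d`. -/
theorem facet_count_superexponential (d : ℕ → ℕ)
    (hd : ∀ᶠ n in atTop, 2 ≤ d n ∧ d n < n)
    (hln : Tendsto (fun n : ℕ => Real.log n / (d n : ℝ)) atTop atTop) :
    Tendsto (fun n : ℕ =>
        FF n (d n) (-1) 1 / ((n : ℝ) * Kd (d n) * hstar n (d n) ^ (d n - 1)))
      atTop (nhds 1) ∧
    (Tendsto (fun n : ℕ => Real.log n / ((d n : ℝ) * Real.log (d n))) atTop atTop →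
      Tendsto (fun n : ℕ => FF n (d n) (-1) 1 / ((n : ℝ) * Kd (d n)))
        atTop (nhds 1)) := by
  set ε : ℕ → ℝ := fun n => (d n : ℝ) ^ (3 / ((d n : ℝ) - 1)) * (n : ℝ) ^ (-2 / ((d n : ℝ) - 1))
    with hε
  have hε0 : Tendsto ε atTop (nhds 0) := by
    have hlim : Tendsto (fun n : ℕ => 8 * Real.exp (-2 * (Real.log n / (d n : ℝ))))
        atTop (nhds 0) := by
      simpa using (Real.tendsto_exp_atBot.comp
        (hln.const_mul_atTop_of_neg (by norm_num : (-2 : ℝ) < 0))).const_mul 8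
    refine tendsto_of_tendsto_of_tendsto_of_le_of_le' tendsto_const_nhds hlim ?_ ?_
    · exact Eventually.of_forall fun n => by positivity
    · filter_upwards [hd] with n hn
      exact (eps_pos_le hn.1 (by omega)).2
  have hhalf : ∀ᶠ n in atTop, ε n ≤ 1 / 2 := hε0.eventually_le_const (by norm_num)
  have h1ε : Tendsto (fun n => 1 - ε n) atTop (nhds 1) := by
    simpa using hε0.const_sub 1
  have hκ : Tendsto (fun n => ε n / (1 - ε n)) atTop (nhds 0) := by
    simpa [Pi.div_def] using hε0.div h1ε one_ne_zero
  have hratio : Tendsto (fun n : ℕ =>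
      FF n (d n) (-1) 1 / ((n : ℝ) * Kd (d n) * hstar n (d n) ^ (d n - 1))) atTop (nhds 1) := by
    have hl : Tendsto (fun n => 1 - 4 * (ε n / (1 - ε n))) atTop (nhds 1) := by
      simpa using (hκ.const_mul 4).const_sub 1
    have hu : Tendsto (fun n => (1 + 12 * (ε n / (1 - ε n))) / (1 - ε n)) atTop (nhds 1) := by
      simpa [Pi.div_def] using ((hκ.const_mul 12).const_add 1).div h1ε one_ne_zero
    refine tendsto_of_tendsto_of_tendsto_of_le_of_le' hl hu ?_ ?_
    · filter_upwards [hd, hhalf] with n hn hh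
      exact (FF_ratio_bounds hn.1 hn.2 rfl hh).1
    · filter_upwards [hd, hhalf] with n hn hh
      exact (FF_ratio_bounds hn.1 hn.2 rfl hh).2
  refine ⟨hratio, fun hlog => ?_⟩
  have hdε := mul_rescale_tendsto_zero hd hln hlog
  have hbounds : ∀ᶠ n in atTop, 1 - d n * ε n ≤ hstar n (d n) ^ (d n - 1) ∧
      hstar n (d n) ^ (d n - 1) ≤ 1 := by
    filter_upwards [hhalf] with n hh
    exact hstar_pow_mem (by positivity) (by linarith) rfl
  have hstar_lim : Tendsto (fun n => hstar n (d n) ^ (d n - 1)) atTop (nhds 1) := by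
    refine tendsto_of_tendsto_of_tendsto_of_le_of_le' ?_ tendsto_const_nhds
      (hbounds.mono fun _ h => h.1) (hbounds.mono fun _ h => h.2)
    simpa using hdε.const_sub 1
  have hprod := hratio.mul hstar_lim
  rw [one_mul] at hprod
  refine hprod.congr' ?_
  filter_upwards [hstar_lim.eventually_ne one_ne_zero] with n hn
  rw [← div_div, div_mul_cancel₀ _ hn]
end

section
/- Fix ρ > 0 and assume d(n) → ∞ and (n − d)/d → ρ. Let f_ρ(r) = ρ·ln Φ(r) − r²/2 and let r_ρ ∈ (0,∞) be its unique maximizer. Then for every fixed r ∈ ℝ, (1/d)·ln I(n,d,−1, r/√d) → f_ρ(min(r, r_ρ)) as n → ∞, and (1/d)·ln I(n,d,−1,1) → f_ρ(r_ρ). -/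
open Filter

/-- `f_ρ(r) = ρ ln Φ(r) - r²/2`. -/
noncomputable def frho (ρ r : ℝ) : ℝ := ρ * Real.log (stdPhi r) - r ^ 2 / 2

section

open Real Set Topology MeasureTheory

theorem integral_rpow_mul_one_sub_rpow_s17 {u v : ℝ} (hu : 0 < u) (hv : 0 < v) :
    ∫ x in (0 : ℝ)..1, x ^ (u - 1) * (1 - x) ^ (v - 1) = ProbabilityTheory.beta u v := by
  have h : Complex.betaIntegral u v
      = ((∫ x in (0 : ℝ)..1, x ^ (u - 1) * (1 - x) ^ (v - 1) : ℝ) : ℂ) := by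
    rw [Complex.betaIntegral, ← intervalIntegral.integral_ofReal]
    refine intervalIntegral.integral_congr fun x hx => ?_
    rw [uIcc_of_le zero_le_one] at hx
    simp only [Complex.ofReal_mul]
    rw [Complex.ofReal_cpow hx.1, Complex.ofReal_cpow (sub_nonneg.2 hx.2)]
    push_cast
    rfl
  rw [ProbabilityTheory.beta_eq_betaIntegralReal u v hu hv, h, Complex.ofReal_re]

theorem integral_one_sub_sq_rpow_s17 {a : ℝ} (ha : 0 ≤ a) :
    ∫ s in (-1 : ℝ)..1, (1 - s ^ 2) ^ a = √π * Gamma (a + 1) / Gamma (a + 3 / 2) := by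
  have hpos : 0 < a + 1 := by linarith
  have h1 : ∫ x in (0 : ℝ)..1, (1 - (2 * x - 1) ^ 2) ^ a
      = 4 ^ a * ProbabilityTheory.beta (a + 1) (a + 1) := by
    rw [← integral_rpow_mul_one_sub_rpow_s17 hpos hpos, ← intervalIntegral.integral_const_mul]
    refine intervalIntegral.integral_congr fun x hx => ?_
    rw [uIcc_of_le zero_le_one] at hx
    have hx' : 0 ≤ 1 - x := sub_nonneg.2 hx.2
    simp only [add_sub_cancel_right]
    rw [← mul_rpow hx.1 hx', ← mul_rpow (by norm_num) (mul_nonneg hx.1 hx')]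
    ring_nf
  have h2 := intervalIntegral.mul_integral_comp_mul_sub (a := 0) (b := 1)
    (f := fun s : ℝ => (1 - s ^ 2) ^ a) 2 1
  norm_num at h2
  rw [← h2, h1, ProbabilityTheory.beta]
  have h3 := Gamma_mul_Gamma_add_half (a + 1)
  have e1 : a + 1 + 1 / 2 = a + 3 / 2 := by ring
  have e2 : a + 1 + (a + 1) = 2 * (a + 1) := by ring
  rw [e1] at h3
  rw [e2]
  have g1 : 0 < Gamma (a + 3 / 2) := Gamma_pos_of_pos (by linarith)
  have g2 : 0 < Gamma (2 * (a + 1)) := Gamma_pos_of_pos (by linarith)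
  rw [← mul_assoc, ← mul_div_assoc, div_eq_div_iff g2.ne' g1.ne']
  have h4 : (2 : ℝ) * 4 ^ a * 2 ^ (1 - 2 * (a + 1)) = 1 := by
    rw [show (4 : ℝ) = 2 ^ (2 : ℝ) by norm_num, ← rpow_mul (by norm_num)]
    nth_rewrite 1 [← rpow_one 2]
    rw [← rpow_add (by norm_num), ← rpow_add (by norm_num)]
    ring_nf
    simp
  calc 2 * 4 ^ a * (Gamma (a + 1) * Gamma (a + 1)) * Gamma (a + 3 / 2)
      = 2 * 4 ^ a * Gamma (a + 1) * (Gamma (a + 1) * Gamma (a + 3 / 2)) := by ring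
    _ = (2 * 4 ^ a * 2 ^ (1 - 2 * (a + 1))) * (√π * Gamma (a + 1) * Gamma (2 * (a + 1))) := by
      rw [h3]; ring
    _ = _ := by rw [h4, one_mul]

/-- The cumulative distribution function of the height of a uniform point on the sphere. -/
noncomputable def heightCdf (d : ℕ) (h : ℝ) : ℝ :=
  c1 d * ∫ s in (-1 : ℝ)..h, (1 - s ^ 2) ^ (((d : ℝ) - 3) / 2)

/-- The rescaled unnormalised density of the height of a uniform point on the sphere. -/
noncomputable def scaledDensity (d : ℕ) (u : ℝ) : ℝ :=
  (max (1 - u ^ 2 / d) 0) ^ (((d : ℝ) - 3) / 2)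

theorem c1_eq_inv_integral {d : ℕ} (hd : 4 ≤ d) :
    c1 d = (∫ s in (-1 : ℝ)..1, (1 - s ^ 2) ^ (((d : ℝ) - 3) / 2))⁻¹ := by
  have hd' : (4 : ℝ) ≤ d := by exact_mod_cast hd
  rw [integral_one_sub_sq_rpow_s17 (by linarith), c1, inv_div]
  ring_nf

theorem continuous_scaledDensity {d : ℕ} (hd : 4 ≤ d) : Continuous (scaledDensity d) := by
  have hd' : (4 : ℝ) ≤ d := by exact_mod_cast hd
  unfold scaledDensity
  exact Continuous.rpow_const (by fun_prop) fun x => Or.inr (by linarith)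

theorem scaledDensity_nonneg (d : ℕ) (u : ℝ) : 0 ≤ scaledDensity d u :=
  rpow_nonneg (le_max_right _ _) _

theorem scaledDensity_le {d : ℕ} (hd : 6 ≤ d) (u : ℝ) :
    scaledDensity d u ≤ exp (-(1 / 4) * u ^ 2) := by
  have hd' : (6 : ℝ) ≤ d := by exact_mod_cast hd
  have h1 : max (1 - u ^ 2 / d) 0 ≤ exp (-(u ^ 2 / d)) :=
    max_le (by linarith [add_one_le_exp (-(u ^ 2 / d))]) (exp_nonneg _)
  calc scaledDensity d u ≤ (exp (-(u ^ 2 / d))) ^ (((d : ℝ) - 3) / 2) :=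
        rpow_le_rpow (le_max_right _ _) h1 (by linarith)
    _ = exp (-(u ^ 2 / d) * (((d : ℝ) - 3) / 2)) := by rw [← exp_mul]
    _ ≤ _ := by
      refine exp_le_exp.2 ?_
      have : -(u ^ 2 / d) * (((d : ℝ) - 3) / 2) - (-(1 / 4) * u ^ 2)
          = - (u ^ 2 * (d - 6) / (4 * d)) := by field_simp; ring
      have h2 : 0 ≤ u ^ 2 * (d - 6) / (4 * d) :=
        div_nonneg (mul_nonneg (sq_nonneg _) (by linarith)) (by linarith)
      linarith

theorem integrable_scaledDensity {d : ℕ} (hd : 6 ≤ d) : Integrable (scaledDensity d) := by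
  refine (integrable_exp_neg_mul_sq (b := 1 / 4) (by norm_num)).mono'
    (continuous_scaledDensity (by omega)).aestronglyMeasurable (ae_of_all _ fun u => ?_)
  rw [norm_of_nonneg (scaledDensity_nonneg d u)]
  exact scaledDensity_le hd u

theorem scaledDensity_eq_zero {d : ℕ} (hd : 4 ≤ d) {u : ℝ} (hu : √d ≤ |u|) :
    scaledDensity d u = 0 := by
  have hd' : (4 : ℝ) ≤ d := by exact_mod_cast hd
  have h1 : (d : ℝ) ≤ u ^ 2 := by
    rw [← sq_abs, ← sq_sqrt (show (0 : ℝ) ≤ d by linarith)]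
    exact pow_le_pow_left₀ (sqrt_nonneg _) hu 2
  rw [scaledDensity, max_eq_right, zero_rpow (by linarith)]
  rw [sub_nonpos, le_div_iff₀ (by linarith)]
  linarith

theorem tendsto_mul_log_one_sub_div (x : ℝ) {E : ℕ → ℝ} {c : ℝ}
    (hE : Tendsto (fun d : ℕ => E d / d) atTop (𝓝 c)) :
    Tendsto (fun d : ℕ => E d * log (1 - x / d)) atTop (𝓝 (-(c * x))) := by
  have h := (Real.tendsto_mul_log_one_add_div_atTop (-x)).comp
    (tendsto_natCast_atTop_atTop (R := ℝ))
  have h2 := hE.mul h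
  rw [mul_neg] at h2
  refine h2.congr' ?_
  filter_upwards [eventually_gt_atTop 0] with d hd
  have : (d : ℝ) ≠ 0 := by positivity
  simp only [Function.comp]
  rw [neg_div, ← sub_eq_add_neg]
  field_simp

theorem eventually_div_natCast_lt (x : ℝ) {c : ℝ} (hc : 0 < c) :
    ∀ᶠ d : ℕ in atTop, x / d < c :=
  (tendsto_const_div_atTop_nhds_zero_nat x).eventually (gt_mem_nhds hc)

theorem tendsto_scaledDensity (u : ℝ) :
    Tendsto (fun d : ℕ => scaledDensity d u) atTop (𝓝 (exp (-u ^ 2 / 2))) := by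
  have hE : Tendsto (fun d : ℕ => (((d : ℝ) - 3) / 2) / d) atTop (𝓝 (1 / 2)) := by
    have h := (tendsto_const_nhds (x := (1 / 2 : ℝ))).sub
      (tendsto_const_div_atTop_nhds_zero_nat (3 / 2))
    rw [sub_zero] at h
    refine h.congr' ?_
    filter_upwards [eventually_gt_atTop 0] with d hd
    field_simp
  have h := (continuous_exp.tendsto _).comp (tendsto_mul_log_one_sub_div (u ^ 2) hE)
  rw [show -(1 / 2 * u ^ 2) = -u ^ 2 / 2 by ring] at h
  refine h.congr' ?_
  filter_upwards [eventually_div_natCast_lt (u ^ 2) one_pos] with d hd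
  rw [scaledDensity, max_eq_left (by linarith), rpow_def_of_pos (by linarith)]
  simp only [Function.comp]
  ring_nf

theorem sqrt_mul_integral_one_sub_sq_rpow {d : ℕ} (hd : 6 ≤ d) {h : ℝ} (hh : h ∈ Icc (-1 : ℝ) 1) :
    √d * ∫ s in (-1 : ℝ)..h, (1 - s ^ 2) ^ (((d : ℝ) - 3) / 2)
      = ∫ u in Iic (√d * h), scaledDensity d u := by
  have hd' : (6 : ℝ) ≤ d := by exact_mod_cast hd
  have hs : 0 < √(d : ℝ) := sqrt_pos.2 (by linarith)
  have hi := integrable_scaledDensity hd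
  have h1 : ∫ s in (-1 : ℝ)..h, (1 - s ^ 2) ^ (((d : ℝ) - 3) / 2)
      = ∫ s in (-1 : ℝ)..h, scaledDensity d (√d * s) := by
    refine intervalIntegral.integral_congr fun s hs => ?_
    rw [uIcc_of_le hh.1] at hs
    have : s ^ 2 ≤ 1 := by nlinarith [hs.1, hs.2, hh.2]
    simp only [scaledDensity]
    rw [mul_pow, sq_sqrt (by linarith), mul_div_cancel_left₀ _ (by linarith),
      max_eq_left (by linarith)]
  rw [h1, intervalIntegral.mul_integral_comp_mul_left, ← intervalIntegral.integral_Iic_sub_Iic hi.integrableOn hi.integrableOn,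
    sub_eq_self]
  refine setIntegral_eq_zero_of_forall_eq_zero fun u hu => ?_
  have hu' : u ≤ -√d := by simpa using hu
  exact scaledDensity_eq_zero (by omega) (by rw [abs_of_nonpos (by linarith)]; linarith)

theorem integral_scaledDensity_pos {d : ℕ} (hd : 6 ≤ d) : 0 < ∫ u, scaledDensity d u := by
  refine (integral_pos_iff_support_of_nonneg (scaledDensity_nonneg d)
    (integrable_scaledDensity hd)).2 ?_
  refine (continuous_scaledDensity (by omega)).isOpen_support.measure_pos _ ⟨0, ?_⟩
  simp [scaledDensity]

theorem integral_Iic_sqrt_scaledDensity {d : ℕ} (hd : 6 ≤ d) :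
    ∫ u in Iic √d, scaledDensity d u = ∫ u, scaledDensity d u := by
  refine setIntegral_eq_integral_of_forall_compl_eq_zero fun u hu => ?_
  exact scaledDensity_eq_zero (by omega) ((not_le.1 hu).le.trans (le_abs_self u))

theorem heightCdf_eq {d : ℕ} (hd : 6 ≤ d) {h : ℝ} (hh : h ∈ Icc (-1 : ℝ) 1) :
    heightCdf d h = (∫ u in Iic (√d * h), scaledDensity d u) / ∫ u, scaledDensity d u := by
  have hd' : (6 : ℝ) ≤ d := by exact_mod_cast hd
  have hs : 0 < √(d : ℝ) := sqrt_pos.2 (by linarith)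
  rw [heightCdf, c1_eq_inv_integral (by omega), ← integral_Iic_sqrt_scaledDensity hd,
    ← sqrt_mul_integral_one_sub_sq_rpow hd hh]
  have h1 := sqrt_mul_integral_one_sub_sq_rpow hd (h := 1) (by norm_num)
  rw [mul_one] at h1
  rw [← h1, mul_div_mul_left _ _ hs.ne']
  exact (div_eq_inv_mul _ _).symm

theorem integral_exp_neg_sq_div_two : ∫ u : ℝ, exp (-u ^ 2 / 2) = √(2 * π) := by
  have h := integral_gaussian (1 / 2)
  rw [show π / (1 / 2) = 2 * π by ring] at h
  rw [← h]
  refine integral_congr_ae (ae_of_all _ fun u => ?_)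
  simp only
  ring_nf

theorem integrable_exp_neg_sq_div_two : Integrable fun u : ℝ => exp (-u ^ 2 / 2) := by
  refine (integrable_exp_neg_mul_sq (b := 1 / 2) (by norm_num)).congr (ae_of_all _ fun u => ?_)
  simp only
  ring_nf

theorem exists_tendsto_abs_heightCdf_sub_stdPhi_le : ∃ δ : ℕ → ℝ, Tendsto δ atTop (𝓝 0) ∧
    ∀ d, 6 ≤ d → ∀ h ∈ Icc (-1 : ℝ) 1, |heightCdf d h - stdPhi (√d * h)| ≤ δ d := by
  set g : ℝ → ℝ := fun u => exp (-u ^ 2 / 2) with hg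
  have hgi : Integrable g := integrable_exp_neg_sq_div_two
  have hgZ : ∫ u, g u = √(2 * π) := integral_exp_neg_sq_div_two
  have hZ : 0 < √(2 * π) := by positivity
  have hdiff : ∀ d, 6 ≤ d → Integrable fun u => scaledDensity d u - g u := fun d hd =>
    (integrable_scaledDensity hd).sub hgi
  have he : Tendsto (fun d : ℕ => ∫ u, |scaledDensity d u - g u|) atTop (𝓝 0) := by
    have h0 : (0 : ℝ) = ∫ _ : ℝ, (0 : ℝ) := by simp
    rw [h0]
    refine tendsto_integral_filter_of_dominated_convergence
      (fun u => exp (-(1 / 4) * u ^ 2) + g u) ?_ ?_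
      ((integrable_exp_neg_mul_sq (by norm_num)).add hgi) ?_
    · filter_upwards [eventually_ge_atTop 6] with d hd
      exact (hdiff d hd).abs.aestronglyMeasurable
    · filter_upwards [eventually_ge_atTop 6] with d hd
      refine ae_of_all _ fun u => ?_
      have h1 := scaledDensity_nonneg d u
      have h2 := scaledDensity_le hd u
      have h3 : 0 < g u := exp_pos _
      rw [norm_eq_abs, abs_abs]
      exact abs_sub_le_iff.2 ⟨by linarith, by linarith [exp_nonneg (-(1 / 4) * u ^ 2)]⟩
    · refine ae_of_all _ fun u => ?_
      have h := ((tendsto_scaledDensity u).sub_const (g u)).abs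
      simpa [hg] using h
  have hle : ∀ d, 6 ≤ d → ∀ s : Set ℝ,
      |(∫ u in s, scaledDensity d u) - ∫ u in s, g u| ≤ ∫ u, |scaledDensity d u - g u| := by
    intro d hd s
    rw [← integral_sub (integrable_scaledDensity hd).integrableOn hgi.integrableOn]
    refine (abs_integral_le_integral_abs).trans ?_
    exact setIntegral_le_integral (hdiff d hd).abs (ae_of_all _ fun u => abs_nonneg _)
  have hZd : Tendsto (fun d : ℕ => ∫ u, scaledDensity d u) atTop (𝓝 √(2 * π)) := by
    rw [tendsto_iff_dist_tendsto_zero]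
    refine squeeze_zero' (Eventually.of_forall fun _ => dist_nonneg) ?_ he
    filter_upwards [eventually_ge_atTop 6] with d hd
    have := hle d hd univ
    rwa [setIntegral_univ, setIntegral_univ, hgZ] at this
  refine ⟨fun d => 2 * (∫ u, |scaledDensity d u - g u|) / ∫ u, scaledDensity d u, ?_, ?_⟩
  · have := (he.const_mul 2).div hZd hZ.ne'
    rw [mul_zero, zero_div] at this
    exact this
  · intro d hd h hh
    beta_reduce
    have hpos := integral_scaledDensity_pos hd
    have h1 := hle d hd (Iic (√d * h))
    have h2 := hle d hd univ
    rw [setIntegral_univ, setIntegral_univ, hgZ] at h2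
    have h3 : ∫ u in Iic (√d * h), g u ≤ √(2 * π) :=
      hgZ ▸ setIntegral_le_integral hgi (ae_of_all _ fun u => (exp_pos _).le)
    have h4 : 0 ≤ ∫ u in Iic (√d * h), g u := integral_nonneg fun u => (exp_pos _).le
    rw [heightCdf_eq hd hh, stdPhi]
    change |_ - (√(2 * π))⁻¹ * ∫ u in Iic (√d * h), g u| ≤ _
    generalize (∫ u in Iic (√d * h), g u) = b at *
    generalize (∫ u in Iic (√d * h), scaledDensity d u) = a at *
    generalize (∫ u, |scaledDensity d u - g u|) = e at *
    generalize (∫ u, scaledDensity d u) = z at *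
    generalize √(2 * π) = Z at *
    have key : a / z - Z⁻¹ * b = ((a - b) + b / Z * (Z - z)) / z := by
      field_simp
      ring
    have hb : b / Z ≤ 1 := (div_le_one hZ).2 h3
    have hb0 : 0 ≤ b / Z := div_nonneg h4 hZ.le
    rw [key, abs_div, abs_of_pos hpos]
    refine div_le_div_of_nonneg_right ?_ hpos.le
    refine (abs_add_le _ _).trans ?_
    rw [abs_mul, abs_of_nonneg hb0, abs_sub_comm Z z]
    nlinarith [abs_nonneg (z - Z)]

theorem hasDerivAt_stdPhi (r : ℝ) :
    HasDerivAt stdPhi ((√(2 * π))⁻¹ * exp (-r ^ 2 / 2)) r := by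
  have hi := integrable_exp_neg_sq_div_two
  have hc : Continuous fun u : ℝ => exp (-u ^ 2 / 2) := by fun_prop
  have h1 : stdPhi = fun r => (√(2 * π))⁻¹ *
      ((∫ u in Iic 0, exp (-u ^ 2 / 2)) + ∫ u in (0 : ℝ)..r, exp (-u ^ 2 / 2)) := by
    ext r
    rw [← intervalIntegral.integral_Iic_sub_Iic hi.integrableOn hi.integrableOn, stdPhi]
    ring
  rw [h1]
  exact ((intervalIntegral.integral_hasDerivAt_right hi.intervalIntegrable
    (hc.stronglyMeasurableAtFilter _ _) hc.continuousAt).const_add _).const_mul _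

theorem stdPhi_pos (r : ℝ) : 0 < stdPhi r := by
  refine mul_pos (by positivity) ?_
  rw [setIntegral_pos_iff_support_of_nonneg_ae (ae_of_all _ fun u => (exp_pos _).le)
    integrable_exp_neg_sq_div_two.integrableOn]
  have : Function.support (fun u : ℝ => exp (-u ^ 2 / 2)) = univ :=
    Function.support_eq_univ fun u => (exp_pos _).ne'
  simp [this]

theorem stdPhi_le_one (r : ℝ) : stdPhi r ≤ 1 := by
  have hZ : 0 < √(2 * π) := by positivity
  rw [stdPhi, inv_mul_le_iff₀ hZ, mul_one, ← integral_exp_neg_sq_div_two]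
  exact setIntegral_le_integral integrable_exp_neg_sq_div_two (ae_of_all _ fun u => (exp_pos _).le)

theorem monotone_stdPhi : Monotone stdPhi :=
  monotone_of_hasDerivAt_nonneg hasDerivAt_stdPhi fun _ => by positivity

theorem continuous_stdPhi : Continuous stdPhi :=
  continuous_iff_continuousAt.2 fun r => (hasDerivAt_stdPhi r).continuousAt

theorem continuous_frho (ρ : ℝ) : Continuous (frho ρ) := by
  unfold frho
  have := continuous_stdPhi.log fun r => (stdPhi_pos r).ne'
  fun_prop

theorem concaveOn_frho {ρ : ℝ} (hρ : 0 ≤ ρ) : ConcaveOn ℝ (Ici 0) (frho ρ) := by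
  have hd : ∀ r, HasDerivAt (frho ρ)
      (ρ * ((√(2 * π))⁻¹ * exp (-r ^ 2 / 2) / stdPhi r) - r) r := fun r => by
    have h := (((hasDerivAt_stdPhi r).log (stdPhi_pos r).ne').const_mul ρ).sub
      ((hasDerivAt_pow 2 r).div_const 2)
    refine h.congr_deriv ?_
    simp
  refine AntitoneOn.concaveOn_of_deriv (convex_Ici 0) (continuous_frho ρ).continuousOn
    (fun r _ => (hd r).differentiableAt.differentiableWithinAt) fun x hx y hy hxy => ?_
  rw [interior_Ici, mem_Ioi] at hx hy
  rw [(hd x).deriv, (hd y).deriv]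
  have h1 : exp (-y ^ 2 / 2) ≤ exp (-x ^ 2 / 2) := exp_le_exp.2 (by nlinarith)
  have h2 := monotone_stdPhi hxy
  have h3 := stdPhi_pos x
  gcongr

theorem frho_monotoneOn {ρ rρ : ℝ} (hρ : 0 ≤ ρ) (hrρ : 0 ≤ rρ)
    (hmax : ∀ r, frho ρ r ≤ frho ρ rρ) : MonotoneOn (frho ρ) (Iic rρ) := by
  have hneg : ∀ s t : ℝ, s ≤ t → t ≤ 0 → frho ρ s ≤ frho ρ t := fun s t hst ht => by
    have h1 := mul_le_mul_of_nonneg_left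
      (log_le_log (stdPhi_pos s) (monotone_stdPhi hst)) hρ
    unfold frho
    nlinarith
  have hpos : ∀ s t : ℝ, 0 ≤ s → s ≤ t → t ≤ rρ → frho ρ s ≤ frho ρ t := fun s t hs hst ht => by
    have h := (concaveOn_frho hρ).min_le_of_mem_Icc (x := s) (y := rρ) (z := t) hs hrρ ⟨hst, ht⟩
    rwa [min_eq_left (hmax s)] at h
  intro s _ t ht hst
  rcases le_total t 0 with h | h
  · exact hneg s t hst h
  rcases le_total s 0 with h' | h'
  · exact (hneg s 0 h' le_rfl).trans (hpos 0 t le_rfl h ht)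
  · exact hpos s t h' hst ht

theorem heightCdf_nonneg {d : ℕ} (hd : 6 ≤ d) {h : ℝ} (hh : h ∈ Icc (-1 : ℝ) 1) :
    0 ≤ heightCdf d h := by
  rw [heightCdf_eq hd hh]
  exact div_nonneg (integral_nonneg fun u => scaledDensity_nonneg d u)
    (integral_scaledDensity_pos hd).le

theorem heightCdf_le_one {d : ℕ} (hd : 6 ≤ d) {h : ℝ} (hh : h ∈ Icc (-1 : ℝ) 1) :
    heightCdf d h ≤ 1 := by
  rw [heightCdf_eq hd hh]
  exact div_le_one_of_le₀ (setIntegral_le_integral (integrable_scaledDensity hd)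
    (ae_of_all _ fun u => scaledDensity_nonneg d u)) (integral_scaledDensity_pos hd).le

theorem monotoneOn_heightCdf {d : ℕ} (hd : 6 ≤ d) :
    MonotoneOn (heightCdf d) (Icc (-1) 1) := by
  intro x hx y hy hxy
  rw [heightCdf_eq hd hx, heightCdf_eq hd hy]
  refine div_le_div_of_nonneg_right ?_ (integral_scaledDensity_pos hd).le
  exact setIntegral_mono_set (integrable_scaledDensity hd).integrableOn
    (ae_of_all _ fun u => scaledDensity_nonneg d u)
    (Iic_subset_Iic.2 (by gcongr)).eventuallyLE

theorem continuous_heightCdf {d : ℕ} (hd : 6 ≤ d) : Continuous (heightCdf d) := by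
  have hd' : (6 : ℝ) ≤ d := by exact_mod_cast hd
  have hc : Continuous fun s : ℝ => (1 - s ^ 2) ^ (((d : ℝ) - 3) / 2) :=
    Continuous.rpow_const (by fun_prop) fun x => Or.inr (by linarith)
  exact continuous_const.mul
    (intervalIntegral.continuous_primitive (fun a b => hc.intervalIntegrable a b) _)

/-- The exponent of `1 - h ^ 2` in the integral `II n d a b`. -/
noncomputable def heightExponent (d : ℕ) : ℝ := ((d : ℝ) ^ 2 - 2 * (d : ℝ) - 1) / 2

/-- The integrand of `II n d a b`. -/
noncomputable def heightWeight (n d : ℕ) (h : ℝ) : ℝ :=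
  (1 - h ^ 2) ^ heightExponent d * heightCdf d h ^ (n - d)

theorem II_eq_integral_heightWeight (n d : ℕ) (a b : ℝ) :
    II n d a b = ∫ h in a..b, heightWeight n d h := rfl

theorem heightExponent_nonneg {d : ℕ} (hd : 6 ≤ d) : 0 ≤ heightExponent d := by
  have hd' : (6 : ℝ) ≤ d := by exact_mod_cast hd
  unfold heightExponent
  nlinarith

theorem tendsto_heightExponent_div :
    Tendsto (fun d : ℕ => heightExponent d / d / d) atTop (𝓝 (1 / 2)) := by
  have h1 := tendsto_const_div_atTop_nhds_zero_nat (1 : ℝ)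
  have h := ((tendsto_const_nhds (x := (1 / 2 : ℝ))).sub h1).sub ((h1.mul h1).div_const 2)
  rw [mul_zero, zero_div, sub_zero, sub_zero] at h
  refine h.congr' ?_
  filter_upwards [eventually_gt_atTop 0] with d hd
  unfold heightExponent
  field_simp

theorem continuous_heightWeight (n : ℕ) {d : ℕ} (hd : 6 ≤ d) :
    Continuous (heightWeight n d) := by
  unfold heightWeight
  exact (Continuous.rpow_const (by fun_prop) fun x => Or.inr (heightExponent_nonneg hd)).mul
    ((continuous_heightCdf hd).pow _)

theorem sq_le_one_of_mem_Icc {h : ℝ} (hh : h ∈ Icc (-1 : ℝ) 1) : h ^ 2 ≤ 1 := by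
  nlinarith [hh.1, hh.2]

theorem heightWeight_nonneg (n : ℕ) {d : ℕ} (hd : 6 ≤ d) {h : ℝ} (hh : h ∈ Icc (-1 : ℝ) 1) :
    0 ≤ heightWeight n d h :=
  mul_nonneg (rpow_nonneg (sub_nonneg.2 (sq_le_one_of_mem_Icc hh)) _)
    (pow_nonneg (heightCdf_nonneg hd hh) _)

theorem one_sub_sq_rpow_heightExponent_le {d : ℕ} (hd : 6 ≤ d) {h : ℝ}
    (hh : h ∈ Icc (-1 : ℝ) 1) :
    (1 - h ^ 2) ^ heightExponent d ≤ exp (d * -(heightExponent d / d / d * (√d * h) ^ 2)) := by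
  have hd' : (6 : ℝ) ≤ d := by exact_mod_cast hd
  calc (1 - h ^ 2) ^ heightExponent d ≤ (exp (-h ^ 2)) ^ heightExponent d :=
        rpow_le_rpow (sub_nonneg.2 (sq_le_one_of_mem_Icc hh))
          (by linarith [add_one_le_exp (-h ^ 2)]) (heightExponent_nonneg hd)
    _ = _ := by
      rw [← exp_mul, mul_pow, sq_sqrt (by linarith)]
      congr 1
      field_simp

theorem eventually_heightWeight_le {d : ℕ → ℕ} {ρ : ℝ}
    (hdi : Tendsto d atTop atTop)
    (hreg : Tendsto (fun n : ℕ => ((n - d n : ℕ) : ℝ) / d n) atTop (𝓝 ρ))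
    (S : ℝ) {ε : ℝ} (hε : 0 < ε) :
    ∀ᶠ n in atTop, ∀ h ∈ Icc (-1 : ℝ) 1, frho ρ (√(d n) * h) ≤ S →
      heightWeight n (d n) h ≤ exp (d n * (S + ε)) := by
  obtain ⟨δ, hδ, hF⟩ := exists_tendsto_abs_heightCdf_sub_stdPhi_le
  set M : ℝ := 2 * √|S| with hM
  have hM2 : M ^ 2 = 4 * |S| := by rw [hM, mul_pow, sq_sqrt (abs_nonneg _)]; norm_num
  have hΦ := stdPhi_pos (-M)
  have hp := tendsto_heightExponent_div.comp hdi
  have h1 : Tendsto (fun n => |heightExponent (d n) / d n / d n - 1 / 2| * M ^ 2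
      + |((n - d n : ℕ) : ℝ) / d n - ρ| * |log (stdPhi (-M))|
      + ((n - d n : ℕ) : ℝ) / d n * (δ (d n) / stdPhi (-M))) atTop (𝓝 0) := by
    have := (((hp.sub_const (1 / 2)).abs.mul_const (M ^ 2)).add
      ((hreg.sub_const ρ).abs.mul_const |log (stdPhi (-M))|)).add
      (hreg.mul ((hδ.comp hdi).div_const (stdPhi (-M))))
    simpa using this
  filter_upwards [hdi.eventually_ge_atTop 6, h1.eventually (gt_mem_nhds hε),
    hp.eventually (lt_mem_nhds (show (1 / 4 : ℝ) < 1 / 2 by norm_num))] with n hd hsmall hp4 h hh hS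
  have hd' : (6 : ℝ) ≤ d n := by exact_mod_cast hd
  have hd0 : (0 : ℝ) < d n := by linarith
  have hF0 := heightCdf_nonneg hd hh
  have hA := one_sub_sq_rpow_heightExponent_le hd hh
  have hFt := hF (d n) hd h hh
  simp only [Function.comp] at hp4
  set p := heightExponent (d n) / d n / d n
  set t := √(d n) * h with ht
  set κ := ((n - d n : ℕ) : ℝ) / d n with hκ
  have hκ0 : 0 ≤ κ := by positivity
  have hkκ : ((n - d n : ℕ) : ℝ) = d n * κ := by rw [hκ]; field_simp
  rcases le_total |t| M with htM | htM
  · have ht2 : t ^ 2 ≤ M ^ 2 := by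
      rw [← sq_abs t]
      exact pow_le_pow_left₀ (abs_nonneg _) htM 2
    have hΦt := stdPhi_pos t
    have hΦM : stdPhi (-M) ≤ stdPhi t := monotone_stdPhi (abs_le.1 htM).1
    have hlog : log (stdPhi (-M)) ≤ log (stdPhi t) := log_le_log hΦ hΦM
    have hlog0 : log (stdPhi t) ≤ 0 := log_nonpos hΦt.le (stdPhi_le_one t)
    have hδ0 : 0 ≤ δ (d n) := (abs_nonneg _).trans hFt
    have hB : heightCdf (d n) h ≤ exp (log (stdPhi t) + δ (d n) / stdPhi (-M)) := by
      rw [exp_add, exp_log hΦt]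
      have h2 : δ (d n) / stdPhi t ≤ δ (d n) / stdPhi (-M) := by gcongr
      have h3 := add_one_le_exp (δ (d n) / stdPhi (-M))
      calc heightCdf (d n) h ≤ stdPhi t + δ (d n) := by linarith [(abs_le.1 hFt).2]
        _ = stdPhi t * (δ (d n) / stdPhi t + 1) := by field_simp; ring
        _ ≤ _ := by gcongr; linarith
    have hBk : heightCdf (d n) h ^ (n - d n)
        ≤ exp (d n * (κ * (log (stdPhi t) + δ (d n) / stdPhi (-M)))) := by
      refine (pow_le_pow_left₀ hF0 hB _).trans_eq ?_
      rw [← exp_nat_mul, hkκ, mul_assoc]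
    refine (mul_le_mul hA hBk (pow_nonneg hF0 _) (exp_nonneg _)).trans ?_
    rw [← exp_add, ← mul_add]
    refine exp_le_exp.2 (mul_le_mul_of_nonneg_left ?_ hd0.le)
    have e1 : (1 / 2 - p) * t ^ 2 ≤ |p - 1 / 2| * M ^ 2 := by
      rw [abs_sub_comm]
      exact mul_le_mul (le_abs_self _) ht2 (sq_nonneg _) (abs_nonneg _)
    have e2 : (κ - ρ) * log (stdPhi t) ≤ |κ - ρ| * |log (stdPhi (-M))| := by
      refine (le_abs_self _).trans ?_
      rw [abs_mul]
      refine mul_le_mul_of_nonneg_left ?_ (abs_nonneg _)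
      rw [abs_of_nonpos hlog0, abs_of_nonpos (hlog.trans hlog0)]
      linarith
    unfold frho at hS
    linarith
  · have ht2 : M ^ 2 ≤ t ^ 2 := by
      rw [← sq_abs t]
      exact pow_le_pow_left₀ (by positivity) htM 2
    have hF1 : heightCdf (d n) h ^ (n - d n) ≤ 1 := pow_le_one₀ hF0 (heightCdf_le_one hd hh)
    refine (mul_le_of_le_one_right
      (rpow_nonneg (sub_nonneg.2 (sq_le_one_of_mem_Icc hh)) _) hF1).trans (hA.trans ?_)
    refine exp_le_exp.2 (mul_le_mul_of_nonneg_left ?_ hd0.le)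
    nlinarith [neg_abs_le S]

theorem tendsto_log_sqrt_div {d : ℕ → ℕ} (hdi : Tendsto d atTop atTop) :
    Tendsto (fun n => log √(d n) / d n) atTop (𝓝 0) := by
  have h := (isLittleO_log_id_atTop.tendsto_div_nhds_zero.comp
    ((tendsto_natCast_atTop_atTop (R := ℝ)).comp hdi)).div_const 2
  rw [zero_div] at h
  refine h.congr fun n => ?_
  simp only [Function.comp, id]
  rw [log_sqrt (Nat.cast_nonneg _)]
  ring

theorem tendsto_sqrt_natCast {d : ℕ → ℕ} (hdi : Tendsto d atTop atTop) :
    Tendsto (fun n => √(d n : ℝ)) atTop atTop :=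
  tendsto_sqrt_atTop.comp ((tendsto_natCast_atTop_atTop (R := ℝ)).comp hdi)

theorem tendsto_heightCdf_div_sqrt {d : ℕ → ℕ} (hdi : Tendsto d atTop atTop) (t : ℝ) :
    Tendsto (fun n => heightCdf (d n) (t / √(d n))) atTop (𝓝 (stdPhi t)) := by
  obtain ⟨δ, hδ, hF⟩ := exists_tendsto_abs_heightCdf_sub_stdPhi_le
  rw [tendsto_iff_dist_tendsto_zero]
  refine squeeze_zero' (Eventually.of_forall fun _ => dist_nonneg) ?_ (hδ.comp hdi)
  filter_upwards [hdi.eventually_ge_atTop 6,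
    (tendsto_sqrt_natCast hdi).eventually_ge_atTop (|t| + 1)] with n hd hs
  have hs0 : 0 < √(d n : ℝ) := by linarith [abs_nonneg t]
  have hmem : t / √(d n : ℝ) ∈ Icc (-1 : ℝ) 1 := by
    rw [mem_Icc, ← abs_le, abs_div, abs_of_pos hs0, div_le_one hs0]
    linarith
  have := hF (d n) hd _ hmem
  rwa [mul_div_cancel₀ _ hs0.ne'] at this

theorem eventually_lt_log_II_div {d : ℕ → ℕ} {ρ : ℝ} {b : ℕ → ℝ} {m c : ℝ}
    (hdi : Tendsto d atTop atTop)
    (hreg : Tendsto (fun n : ℕ => ((n - d n : ℕ) : ℝ) / d n) atTop (𝓝 ρ))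
    (hb : ∀ᶠ n in atTop, m / √(d n) ≤ b n ∧ b n ≤ 1) (hc : c < frho ρ m) :
    ∀ᶠ n in atTop, 0 < II n (d n) (-1) (b n) ∧ c < log (II n (d n) (-1) (b n)) / d n := by
  obtain ⟨η, hη, hη0⟩ : ∃ η : ℝ,
      c < -(1 / 2 * (|m| + η) ^ 2) + ρ * log (stdPhi (m - η)) ∧ 0 < η := by
    have hcont : Continuous fun η : ℝ =>
        -(1 / 2 * (|m| + η) ^ 2) + ρ * log (stdPhi (m - η)) := by
      have := (continuous_stdPhi.log fun r => (stdPhi_pos r).ne').comp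
        (continuous_const.sub continuous_id : Continuous fun η : ℝ => m - η)
      simp only [Function.comp_def] at this
      fun_prop
    have h0 : c < -(1 / 2 * (|m| + 0) ^ 2) + ρ * log (stdPhi (m - 0)) := by
      rw [add_zero, sub_zero, sq_abs]
      unfold frho at hc
      linarith
    exact ((hcont.continuousAt.eventually (lt_mem_nhds h0)).filter_mono nhdsWithin_le_nhds
      |>.and (self_mem_nhdsWithin (s := Ioi (0 : ℝ)))).exists
  set L := (|m| + η) ^ 2 with hL
  have hΦ := stdPhi_pos (m - η)
  have hFlim := tendsto_heightCdf_div_sqrt hdi (m - η)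
  have hlim : Tendsto (fun n => log η / d n - log √(d n) / d n
      + heightExponent (d n) / d n * log (1 - L / d n)
      + ((n - d n : ℕ) : ℝ) / d n * log (heightCdf (d n) ((m - η) / √(d n)))) atTop
      (𝓝 (-(1 / 2 * L) + ρ * log (stdPhi (m - η)))) := by
    have := (((((tendsto_const_div_atTop_nhds_zero_nat (log η)).comp hdi).sub
      (tendsto_log_sqrt_div hdi)).add
      ((tendsto_mul_log_one_sub_div L tendsto_heightExponent_div).comp hdi)).add
      (hreg.mul (hFlim.log hΦ.ne')))
    rw [sub_zero, zero_add] at this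
    exact this
  filter_upwards [hb, hlim.eventually (lt_mem_nhds hη), hFlim.eventually (lt_mem_nhds hΦ),
    hdi.eventually (eventually_div_natCast_lt L one_pos), hdi.eventually_ge_atTop 6,
    (tendsto_sqrt_natCast hdi).eventually_ge_atTop (|m| + η)] with n hbn hlow hFpos hL1 hd hs
  have hs0 : 0 < √(d n : ℝ) := by linarith [abs_nonneg m]
  have hd0 : (0 : ℝ) < d n := sqrt_pos.1 hs0
  have hx1 : -1 ≤ (m - η) / √(d n) := by
    rw [le_div_iff₀ hs0]
    linarith [neg_abs_le m]
  have hxy : (m - η) / √(d n) ≤ m / √(d n) := by gcongr; linarith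
  have hy1 : m / √(d n) ≤ 1 := hbn.1.trans hbn.2
  set w := (1 - L / d n) ^ heightExponent (d n)
    * heightCdf (d n) ((m - η) / √(d n)) ^ (n - d n)
  have hw1 : 0 < (1 - L / d n) ^ heightExponent (d n) := rpow_pos_of_pos (by linarith) _
  have hw2 : 0 < heightCdf (d n) ((m - η) / √(d n)) ^ (n - d n) := pow_pos hFpos _
  have hwle : ∀ h ∈ Icc ((m - η) / √(d n)) (m / √(d n)), w ≤ heightWeight n (d n) h := by
    intro h hh
    have hmem : h ∈ Icc (-1 : ℝ) 1 := ⟨hx1.trans hh.1, hh.2.trans hy1⟩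
    have hsq : h ^ 2 ≤ L / d n := by
      have h1 := (div_le_iff₀ hs0).1 hh.1
      have h2 := (le_div_iff₀ hs0).1 hh.2
      have h3 : |h * √(d n)| ≤ |m| + η :=
        abs_le.2 ⟨by linarith [neg_abs_le m], by linarith [le_abs_self m]⟩
      rw [le_div_iff₀ hd0, hL, ← sq_sqrt hd0.le, ← mul_pow, ← sq_abs (h * _)]
      exact pow_le_pow_left₀ (abs_nonneg _) h3 2
    refine mul_le_mul ?_ ?_ hw2.le
      (rpow_nonneg (sub_nonneg.2 (sq_le_one_of_mem_Icc hmem)) _)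
    · exact rpow_le_rpow (by linarith) (by linarith) (heightExponent_nonneg hd)
    · exact pow_le_pow_left₀ hFpos.le
        (monotoneOn_heightCdf hd ⟨hx1, hxy.trans hy1⟩ hmem hh.1) _
  have hint : ∀ x y, IntervalIntegrable (heightWeight n (d n)) volume x y := fun x y =>
    (continuous_heightWeight n hd).intervalIntegrable x y
  have hII : η / √(d n) * w ≤ II n (d n) (-1) (b n) := by
    calc η / √(d n) * w = ∫ _ in ((m - η) / √(d n))..(m / √(d n)), w := by
          rw [intervalIntegral.integral_const, smul_eq_mul]
          ring
      _ ≤ ∫ h in ((m - η) / √(d n))..(m / √(d n)), heightWeight n (d n) h :=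
          intervalIntegral.integral_mono_on hxy (by simp) (hint _ _) hwle
      _ ≤ ∫ h in (-1)..(b n), heightWeight n (d n) h := by
          refine intervalIntegral.integral_mono_interval hx1 hxy hbn.1 ?_ (hint _ _)
          refine (ae_restrict_iff' measurableSet_Ioc).2 (ae_of_all _ fun h hh => ?_)
          exact heightWeight_nonneg n hd ⟨hh.1.le, hh.2.trans hbn.2⟩
  have hηs : 0 < η / √(d n) := div_pos hη0 hs0
  have hpos : 0 < η / √(d n) * w := mul_pos hηs (mul_pos hw1 hw2)
  refine ⟨hpos.trans_le hII, hlow.trans_le ?_⟩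
  refine le_trans (le_of_eq ?_) (div_le_div_of_nonneg_right (log_le_log hpos hII) hd0.le)
  rw [log_mul hηs.ne' (mul_pos hw1 hw2).ne', log_mul hw1.ne' hw2.ne', log_pow,
    log_rpow (by linarith), log_div hη0.ne' hs0.ne']
  ring

theorem tendsto_log_II_div {d : ℕ → ℕ} {ρ : ℝ} {b : ℕ → ℝ} {m : ℝ}
    (hdi : Tendsto d atTop atTop)
    (hreg : Tendsto (fun n : ℕ => ((n - d n : ℕ) : ℝ) / d n) atTop (𝓝 ρ))
    (hb : ∀ᶠ n in atTop, m / √(d n) ≤ b n ∧ b n ≤ 1)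
    (hm : ∀ᶠ n in atTop, ∀ h ≤ b n, frho ρ (√(d n) * h) ≤ frho ρ m) :
    Tendsto (fun n => log (II n (d n) (-1) (b n)) / d n) atTop (𝓝 (frho ρ m)) := by
  refine tendsto_order.2 ⟨fun c hc => ?_, fun c hc => ?_⟩
  · exact (eventually_lt_log_II_div hdi hreg hb hc).mono fun n hn => hn.2
  set S := frho ρ m with hS
  have hε : 0 < (c - S) / 2 := by linarith
  filter_upwards [eventually_lt_log_II_div hdi hreg hb (sub_one_lt (frho ρ m)), hb, hm,
    eventually_heightWeight_le hdi hreg S hε,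
    hdi.eventually (eventually_div_natCast_lt (log 2) hε), hdi.eventually_ge_atTop 6,
    (tendsto_sqrt_natCast hdi).eventually_ge_atTop (|m| + 1)] with n hpos hbn hmn hle h2 hd hs
  have hs0 : 0 < √(d n : ℝ) := by linarith [abs_nonneg m]
  have hd0 : (0 : ℝ) < d n := sqrt_pos.1 hs0
  have hb1 : -1 ≤ b n := by
    refine le_trans ?_ hbn.1
    rw [le_div_iff₀ hs0]
    linarith [neg_abs_le m]
  have hII : II n (d n) (-1) (b n) ≤ 2 * exp (d n * (S + (c - S) / 2)) := by
    calc II n (d n) (-1) (b n)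
        ≤ ∫ _ in (-1)..(b n), exp (d n * (S + (c - S) / 2)) :=
          intervalIntegral.integral_mono_on hb1
            ((continuous_heightWeight n hd).intervalIntegrable _ _) (by simp)
            fun h hh => hle h ⟨hh.1, hh.2.trans hbn.2⟩ (hmn h hh.2)
      _ = (b n + 1) * exp (d n * (S + (c - S) / 2)) := by
          rw [intervalIntegral.integral_const, smul_eq_mul, sub_neg_eq_add]
      _ ≤ _ := by gcongr; linarith [hbn.2]
  have hlog := log_le_log hpos.1 hII
  rw [log_mul two_ne_zero (exp_pos _).ne', log_exp] at hlog
  rw [div_lt_iff₀ hd0] at h2 ⊢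
  nlinarith

end

/-- in the linear regime `(n-d)/d → ρ > 0`,
`(1/d)·ln I(n,d,-1,r/√d) → f_ρ(min(r,r_ρ))` and `(1/d)·ln I(n,d,-1,1) → f_ρ(r_ρ)`. -/
theorem I_asymptotics_linear (d : ℕ → ℕ) (ρ : ℝ) (hρ : 0 < ρ)
    (hd : ∀ᶠ n in atTop, 2 ≤ d n ∧ d n < n)
    (hdi : Tendsto (fun n : ℕ => (d n : ℝ)) atTop atTop)
    (hreg : Tendsto (fun n : ℕ => ((n : ℝ) - (d n : ℝ)) / (d n : ℝ)) atTop (nhds ρ))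
    (rρ : ℝ) (hrρ : 0 < rρ)
    (hmax : ∀ r : ℝ, r ≠ rρ → frho ρ r < frho ρ rρ) :
    (∀ r : ℝ,
      Tendsto (fun n : ℕ => Real.log (II n (d n) (-1) (r / Real.sqrt (d n))) / (d n : ℝ))
        atTop (nhds (frho ρ (min r rρ)))) ∧
    Tendsto (fun n : ℕ => Real.log (II n (d n) (-1) 1) / (d n : ℝ))
      atTop (nhds (frho ρ rρ)) := by

  have hdi' : Tendsto d atTop atTop := tendsto_natCast_atTop_iff.1 hdi
  have hreg' : Tendsto (fun n : ℕ => ((n - d n : ℕ) : ℝ) / d n) atTop (nhds ρ) := by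
    refine hreg.congr' ?_
    filter_upwards [hd] with n hn
    rw [Nat.cast_sub hn.2.le]
  have hmax' : ∀ r, frho ρ r ≤ frho ρ rρ := fun r => by
    rcases eq_or_ne r rρ with rfl | h
    · exact le_rfl
    · exact (hmax r h).le
  refine ⟨fun r => ?_, ?_⟩
  · refine tendsto_log_II_div hdi' hreg' ?_ ?_
    · filter_upwards [(tendsto_sqrt_natCast hdi').eventually_ge_atTop (|r| + 1)] with n hs
      have hs0 : 0 < √(d n : ℝ) := by linarith [abs_nonneg r]
      refine ⟨by gcongr; exact min_le_left _ _, ?_⟩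
      rw [div_le_one hs0]
      linarith [le_abs_self r]
    · filter_upwards [(tendsto_sqrt_natCast hdi').eventually_gt_atTop 0] with n hs h hh
      have hr : √(d n : ℝ) * h ≤ r := by rwa [le_div_iff₀' hs] at hh
      rcases le_total rρ r with h' | h'
      · rw [min_eq_right h']
        exact hmax' _
      · rw [min_eq_left h']
        exact frho_monotoneOn hρ.le hrρ.le hmax' (hr.trans h') h' hr
  · refine tendsto_log_II_div hdi' hreg' ?_ (Eventually.of_forall fun n h _ => hmax' _)
    filter_upwards [(tendsto_sqrt_natCast hdi').eventually_ge_atTop rρ] with n hs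
    exact ⟨div_le_one_of_le₀ hs (Real.sqrt_nonneg _), le_rfl⟩
end
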